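/- arXiv:2602.10391 — 4 statements merged into one kernel-verified Lean document; each statement's English description precedes it below -/
import Mathlib

section
/- Let r ≥ 2 be an integer, let k_1, …, k_r be positive integers, let a_1, …, a_r ∈ ℂ∖ℤ satisfy a_j − a_i ∉ {−1,−2,−3,…} for all 1 ≤ i < j ≤ r, and let x_1, …, x_r be roots of unity with (k_1, x_1) ≠ (1,1), (k_r, x_r) ≠ (1,1) and x_1 x_2 ⋯ x_r ≠ 1. Then Li_{k_1,…,k_r}(x_1,…,x_r; a_1,…,a_r) − (−1)^{k_1+⋯+k_r−1} (x_1⋯x_r) · Li_{k_r,…,k_1}(x_r^{−1},…,x_1^{−1}; 1−a_r,…,1−a_1) belongs to the K-subalgebra of ℂ generated by all convergent cyclotomic multiple Hurwitz zeta values of depth at most r − 1 whose variable entries are roots of unity and whose parameter entries all lie in the set {a_i, 1−a_i, 1+a_i−a_j, 1−a_i+a_j : 1 ≤ i, j ≤ r}. -/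
open Filter Finset

/-- A complex number is a root of unity if some positive power of it equals 1. -/
def IsRootOfUnity (z : ℂ) : Prop := ∃ N : ℕ, 0 < N ∧ z ^ N = 1

open scoped Classical in
/-- Partial sum `Σ_{0<n_1<⋯<n_r≤N} Π_j x_j^{n_j} (n_j + b_j − 1)^{−k_j}` where the list `K`
consists of the triples `(k_j, x_j, b_j)`. -/
noncomputable def cmhzP (K : List (ℕ × ℂ × ℂ)) (N : ℕ) : ℂ :=
  ∑ n ∈ Finset.univ.filter (fun n : Fin K.length → Fin N => StrictMono n),
    ∏ j : Fin K.length,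
      (K.get j).2.1 ^ ((n j : ℕ) + 1) /
        ((((n j : ℕ) + 1 : ℕ) : ℂ) + (K.get j).2.2 - 1) ^ (K.get j).1

/-- Cyclotomic multiple Hurwitz zeta value: the limit of the partial sums `cmhzP`. -/
noncomputable def cmhz (K : List (ℕ × ℂ × ℂ)) : ℂ := limUnder atTop (cmhzP K)

/-- Cyclotomic multiple zeta value (all Hurwitz parameters equal to 1). -/
noncomputable def cmzv (K : List (ℕ × ℂ)) : ℂ := cmhz (K.map fun p => (p.1, p.2, 1))

/-- Cyclotomic multiple t-value (all Hurwitz parameters equal to 1/2). -/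
noncomputable def tval (K : List (ℕ × ℂ)) : ℂ := cmhz (K.map fun p => (p.1, p.2, (1 : ℂ)/2))

/-- Depth-one cyclotomic zeta value `Li_k(x)`. -/
noncomputable def li1 (k : ℕ) (x : ℂ) : ℂ := cmzv [(k, x)]

/-- Depth-one cyclotomic Hurwitz zeta value `Li_k(x; b)`. -/
noncomputable def lih1 (k : ℕ) (x b : ℂ) : ℂ := cmhz [(k, x, b)]

/-- Depth-one cyclotomic t-value `t_k(x)`. -/
noncomputable def tval1 (k : ℕ) (x : ℂ) : ℂ := tval [(k, x)]

/-- The generalized digamma-type series `φ(s; x) = Σ_{k≥0} x^k/(k+s)`. -/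
noncomputable def phiF (s x : ℂ) : ℂ :=
  limUnder atTop (fun N : ℕ => ∑ t ∈ Finset.range (N + 1), x ^ t / ((t : ℂ) + s))

/-- The extended trigonometric function `Φ(s; x) = φ(s; x) − φ(−s; x⁻¹) − 1/s`. -/
noncomputable def PhiF (s x : ℂ) : ℂ := phiF s x - phiF (-s) x⁻¹ - 1 / s



/-- Iterated sum over `a ≤ n_1 < ... < n_r < b`. -/
noncomputable def itS : List (ℤ → ℂ) → ℤ → ℤ → ℂ
  | [], _, _ => 1
  | f :: F, a, b => ∑ n ∈ Finset.Ico a b, f n * itS F (n + 1) b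

theorem itS_split (F : List (ℤ → ℂ)) : ∀ (a b c : ℤ), a ≤ c → c ≤ b →
    itS F a b = ∑ p ∈ Finset.range (F.length + 1), itS (F.take p) a c * itS (F.drop p) c b := by
  induction F with
  | nil => intro a b c _ _; simp [itS]
  | cons f F ih =>
    intro a b c hac hcb
    rw [List.length_cons, Finset.sum_range_succ']
    simp only [List.take_zero, List.drop_zero, List.take_succ_cons, List.drop_succ_cons]
    rw [show itS [] a c = 1 from rfl, one_mul]
    simp only [itS]
    rw [← Finset.Ico_union_Ico_eq_Ico hac hcb,
      Finset.sum_union (Finset.Ico_disjoint_Ico_consecutive a c b)]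
    congr 1
    simp only [Finset.sum_mul]
    rw [Finset.sum_comm]
    refine Finset.sum_congr rfl fun n hn => ?_
    rw [Finset.mem_Ico] at hn
    rw [ih (n+1) b c (by omega) hcb, Finset.mul_sum]
    refine Finset.sum_congr rfl fun p _ => ?_
    ring

theorem itS_mid (f : ℤ → ℂ) (H : List (ℤ → ℂ)) (b : ℤ) (G : List (ℤ → ℂ)) : ∀ (a : ℤ),
    itS (G ++ f :: H) a b = ∑ n ∈ Finset.Ico a b, f n * (itS G a n * itS H (n + 1) b) := by
  induction G with
  | nil => intro a; simp [itS]
  | cons g G ih =>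
    intro a
    simp only [List.cons_append, itS]
    simp only [ih, Finset.mul_sum, Finset.sum_mul]
    rw [Finset.sum_comm' (t' := Finset.Ico a b) (s' := fun n => Finset.Ico a n)]
    · refine Finset.sum_congr rfl fun n _ => Finset.sum_congr rfl fun m _ => ?_
      ring
    · intro x y
      simp only [Finset.mem_Ico]
      omega

theorem itS_snoc (f : ℤ → ℂ) (G : List (ℤ → ℂ)) (a b : ℤ) :
    itS (G ++ [f]) a b = ∑ n ∈ Finset.Ico a b, f n * itS G a n := by
  rw [itS_mid]; simp [itS]

theorem itS_reflect (c : ℤ) (F : List (ℤ → ℂ)) : ∀ (a b : ℤ),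
    itS F a b = itS (F.reverse.map fun f n => f (c - n)) (c + 1 - b) (c + 1 - a) := by
  induction F with
  | nil => intro a b; simp [itS]
  | cons f F ih =>
    intro a b
    rw [List.reverse_cons, List.map_append, List.map_cons, List.map_nil, itS_snoc]
    simp only [itS]
    refine Finset.sum_bij' (fun n _ => c - n) (fun n _ => c - n) ?_ ?_ ?_ ?_ ?_
    · intro n hn; simp only [Finset.mem_Ico] at hn ⊢; omega
    · intro n hn; simp only [Finset.mem_Ico] at hn ⊢; omega
    · intro n _; ring
    · intro n _; ring
    · intro n _
      rw [ih (n+1) b]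
      congr 2 <;> ring

theorem itS_shift (c : ℤ) (F : List (ℤ → ℂ)) : ∀ (a b : ℤ),
    itS F a b = itS (F.map fun f n => f (c + n)) (a - c) (b - c) := by
  induction F with
  | nil => intro a b; simp [itS]
  | cons f F ih =>
    intro a b
    simp only [List.map_cons, itS]
    refine Finset.sum_bij' (fun n _ => n - c) (fun n _ => c + n) ?_ ?_ ?_ ?_ ?_
    · intro n hn; simp only [Finset.mem_Ico] at hn ⊢; omega
    · intro n hn; simp only [Finset.mem_Ico] at hn ⊢; omega
    · intro n _; ring
    · intro n _; ring
    · intro n _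
      rw [ih (n+1) b]
      congr 2 <;> ring

theorem itS_scale {ι : Type} (J : List ι) (f g : ι → ℤ → ℂ) (c : ι → ℂ)
    (h : ∀ j ∈ J, ∀ n, f j n = c j * g j n) : ∀ (a b : ℤ),
    itS (J.map f) a b = (J.map c).prod * itS (J.map g) a b := by
  induction J with
  | nil => intro a b; simp [itS]
  | cons j J ih =>
    intro a b
    simp only [List.map_cons, itS, List.prod_cons, Finset.mul_sum]
    refine Finset.sum_congr rfl fun n _ => ?_
    rw [ih (fun j hj => h j (List.mem_cons_of_mem _ hj)), h j List.mem_cons_self]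
    ring

/-- Strictly increasing tuples with entries in `[a,b)`. -/
noncomputable def smT (r : ℕ) (a b : ℤ) : Finset (Fin r → ℤ) := by
  classical
  exact (Fintype.piFinset fun _ => Finset.Ico a b).filter StrictMono

theorem mem_smT {r : ℕ} {a b : ℤ} {n : Fin r → ℤ} :
    n ∈ smT r a b ↔ (∀ i, a ≤ n i ∧ n i < b) ∧ StrictMono n := by
  simp [smT]

theorem sum_smT (r : ℕ) : ∀ (f : Fin r → ℤ → ℂ) (a b : ℤ),
    ∑ n ∈ smT r a b, ∏ j, f j (n j) = itS (List.ofFn f) a b := by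
  induction r with
  | zero =>
    intro f a b
    have : smT 0 a b = {Fin.elim0} := by
      ext n
      rw [mem_smT, Finset.mem_singleton]
      constructor
      · intro _; exact Subsingleton.elim _ _
      · intro _; exact ⟨fun i => i.elim0, fun i => i.elim0⟩
    rw [this]; simp [itS]
  | succ r ih =>
    intro f a b
    rw [List.ofFn_succ]
    simp only [itS]
    simp only [← ih, Finset.mul_sum]
    rw [Finset.sum_sigma']
    refine Finset.sum_bij' (fun n _ => ⟨n 0, fun j => n j.succ⟩) (fun p _ => Fin.cons p.1 p.2) ?_ ?_ ?_ ?_ ?_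
    · intro n hn
      rw [mem_smT] at hn
      rw [Finset.mem_sigma, Finset.mem_Ico, mem_smT]
      refine ⟨hn.1 0, fun i => ⟨?_, (hn.1 i.succ).2⟩, fun i j hij => hn.2 (by simpa using hij)⟩
      have := hn.2 (Fin.succ_pos i)
      simp only
      omega
    · intro p hp
      rw [Finset.mem_sigma, Finset.mem_Ico, mem_smT] at hp
      rw [mem_smT]
      refine ⟨fun i => ?_, ?_⟩
      · refine Fin.cases ?_ (fun i => ?_) i
        · simpa using hp.1
        · have := hp.2.1 i
          simp only [Fin.cons_succ]
          omega
      · intro i j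
        refine Fin.cases ?_ (fun i => ?_) i <;> refine Fin.cases ?_ (fun j => ?_) j
        · simp
        · intro _
          have := hp.2.1 j
          simp only [Fin.cons_succ, Fin.cons_zero]
          omega
        · simp
        · intro h
          simp only [Fin.cons_succ]
          exact hp.2.2 (by simpa using h)
    · intro n _
      exact Fin.cons_self_tail n
    · intro p _; rfl
    · intro n _
      rw [Fin.prod_univ_succ]

/-- Summand attached to a triple, as a function on all integers. -/
noncomputable def phT (p : ℕ × ℂ × ℂ) (n : ℤ) : ℂ := p.2.1 ^ (n + 1) / ((n : ℂ) + p.2.2) ^ p.1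

theorem cmhzP_eq (K : List (ℕ × ℂ × ℂ)) (N : ℕ) : cmhzP K N = itS (K.map phT) 0 N := by
  have : K.map phT = List.ofFn (fun j : Fin K.length => phT (K.get j)) := by
    conv_lhs => rw [← List.ofFn_get K]
    rw [List.map_ofFn]; rfl
  rw [this, ← sum_smT, cmhzP]
  refine Finset.sum_bij' (fun n _ => fun j => ((n j : ℕ) : ℤ))
    (fun n hn => fun j => ⟨(n j).toNat, by have := (mem_smT.1 hn).1 j; omega⟩) ?_ ?_ ?_ ?_ ?_
  · intro n hn
    simp only [Finset.mem_filter, Finset.mem_univ, true_and] at hn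
    rw [mem_smT]
    refine ⟨fun i => ⟨by positivity, by exact_mod_cast (n i).2⟩, fun i j h => ?_⟩
    have h3 := hn h
    rw [Fin.lt_def] at h3
    simp only
    omega
  · intro n hn
    rw [mem_smT] at hn
    simp only [Finset.mem_filter, Finset.mem_univ, true_and]
    intro i j h
    have h1 := hn.2 h
    have h2 := hn.1 i
    rw [Fin.lt_def]
    simp only
    omega
  · intro n _; ext j; simp
  · intro n hn; ext j
    have := (mem_smT.1 hn).1 j
    simp only
    omega
  · intro n _
    refine Finset.prod_congr rfl fun j _ => ?_
    rw [phT]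
    have e1 : ((n j : ℕ) : ℤ) + 1 = (((n j : ℕ) + 1 : ℕ) : ℤ) := by push_cast; ring
    simp only
    rw [e1, zpow_natCast]
    congr 2
    push_cast
    ring

/-- Fourth root of `n+1`. -/
noncomputable def qr (n : ℕ) : ℝ := Real.sqrt (Real.sqrt ((n : ℝ) + 1))

theorem qr_pow (n : ℕ) : qr n ^ 4 = (n : ℝ) + 1 := by
  rw [qr, show (4 : ℕ) = 2 * 2 from rfl, pow_mul, Real.sq_sqrt (Real.sqrt_nonneg _),
    Real.sq_sqrt (by positivity)]

theorem qr_pos (n : ℕ) : 0 < qr n := by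
  rw [qr]; positivity

theorem qr_one_le (n : ℕ) : 1 ≤ qr n := by
  rw [qr]
  rw [Real.one_le_sqrt, Real.one_le_sqrt]
  have : (0 : ℝ) ≤ n := by positivity
  linarith

theorem qr_mono (n : ℕ) : qr n ≤ qr (n + 1) := by
  rw [qr, qr]
  refine Real.sqrt_le_sqrt (Real.sqrt_le_sqrt ?_)
  push_cast
  linarith

theorem qr_two (n : ℕ) : qr (n + 1) ≤ 2 * qr n := by
  refine le_of_pow_le_pow_left₀ (n := 4) (by norm_num) (by have := qr_pos n; positivity) ?_
  rw [mul_pow, qr_pow, qr_pow]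
  push_cast
  have : (0 : ℝ) ≤ n := by positivity
  linarith

theorem qr_diff (n : ℕ) : 1 / (32 * qr n ^ 3) ≤ qr (n + 1) - qr n := by
  have h1 := qr_pow n
  have h2 := qr_pow (n + 1)
  have h3 := qr_two n
  have h4 := qr_mono n
  have h5 := qr_pos n
  push_cast at h2
  set t := qr n
  set s := qr (n + 1)
  have h6 : (s - t) * ((s + t) * (s ^ 2 + t ^ 2)) = 1 := by
    have : (s - t) * ((s + t) * (s ^ 2 + t ^ 2)) = s ^ 4 - t ^ 4 := by ring
    rw [this]; linarith
  have h7 : (s + t) * (s ^ 2 + t ^ 2) ≤ (3 * t) * ((2 * t) ^ 2 + t ^ 2) := by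
    have hs : 0 < s := lt_of_lt_of_le h5 h4
    gcongr
    linarith
  have h8 : (3 * t) * ((2 * t) ^ 2 + t ^ 2) = 15 * t ^ 3 := by ring
  rw [div_le_iff₀ (by positivity), ← h6]
  refine mul_le_mul_of_nonneg_left ?_ (by linarith)
  have : 0 < t ^ 3 := by positivity
  linarith

theorem qr_tendsto : Tendsto (fun n => 1 / qr n) atTop (nhds 0) := by
  have h : Tendsto qr atTop atTop := by
    unfold qr
    refine Real.tendsto_sqrt_atTop.comp (Real.tendsto_sqrt_atTop.comp ?_)
    exact tendsto_atTop_add_const_right _ _ tendsto_natCast_atTop_atTop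
  have h2 := h.inv_tendsto_atTop
  simp only [one_div]
  exact h2

theorem qr_rate_growth (u : ℕ → ℂ) (C : ℝ) (hC : 0 ≤ C)
    (h : ∀ n, ‖u (n + 1) - u n‖ ≤ C / qr n ^ 3) : ∃ C', 0 ≤ C' ∧ ∀ n, ‖u n‖ ≤ C' * qr n := by
  refine ⟨‖u 0‖ + 32 * C, by positivity, ?_⟩
  have key : ∀ n, ‖u n‖ ≤ ‖u 0‖ + 32 * C * qr n := by
    intro n
    induction n with
    | zero =>
      have := qr_pos 0
      have : 0 ≤ 32 * C * qr 0 := by positivity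
      linarith
    | succ n ih =>
      have h1 : ‖u (n + 1)‖ ≤ ‖u (n + 1) - u n‖ + ‖u n‖ := by
        simpa using norm_add_le (u (n + 1) - u n) (u n)
      have h2 := h n
      have h3 := mul_le_mul_of_nonneg_left (qr_diff n) (show 0 ≤ 32 * C by positivity)
      have h4 : 32 * C * (1 / (32 * qr n ^ 3)) = C / qr n ^ 3 := by
        have := qr_pos n
        field_simp
      rw [h4] at h3
      linarith
  intro n
  have h1 := key n
  have h2 := mul_le_mul_of_nonneg_left (qr_one_le n) (norm_nonneg (u 0))
  linarith

theorem qr_diff3 (n : ℕ) : 1 / (256 * qr n ^ 7) ≤ 1 / qr n ^ 3 - 1 / qr (n + 1) ^ 3 := by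
  have h3 := qr_two n
  have h4 := qr_mono n
  have h5 := qr_pos n
  have h1 := qr_diff n
  set t := qr n
  set s := qr (n + 1)
  have hs : 0 < s := lt_of_lt_of_le h5 h4
  have e : 1 / t ^ 3 - 1 / s ^ 3 = (s - t) * (s ^ 2 + s * t + t ^ 2) / (s ^ 3 * t ^ 3) := by
    field_simp
    ring
  rw [e]
  have h6 : 1 / (32 * t ^ 3) * (t ^ 2) / ((2 * t) ^ 3 * t ^ 3) ≤
      (s - t) * (s ^ 2 + s * t + t ^ 2) / (s ^ 3 * t ^ 3) := by
    gcongr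
    · have : 0 ≤ s ^ 2 + s * t := by positivity
      linarith
  refine le_trans (le_of_eq ?_) h6
  field_simp
  norm_num

theorem qr_rate_conv (u : ℕ → ℂ) (C : ℝ) (hC : 0 ≤ C)
    (h : ∀ n, ‖u (n + 1) - u n‖ ≤ C / qr n ^ 7) :
    ∃ l C', 0 ≤ C' ∧ ∀ n, ‖u n - l‖ ≤ C' / qr n ^ 3 := by
  have key : ∀ n m, ‖u (n + m) - u n‖ ≤ 256 * C * (1 / qr n ^ 3 - 1 / qr (n + m) ^ 3) := by
    intro n m
    induction m with
    | zero => simp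
    | succ m ih =>
      have h1 : ‖u (n + m + 1) - u n‖ ≤ ‖u (n + m + 1) - u (n + m)‖ + ‖u (n + m) - u n‖ := by
        simpa using norm_add_le (u (n + m + 1) - u (n + m)) (u (n + m) - u n)
      have h2 := h (n + m)
      have h3 := mul_le_mul_of_nonneg_left (qr_diff3 (n + m)) (show 0 ≤ 256 * C by positivity)
      have h4 : 256 * C * (1 / (256 * qr (n + m) ^ 7)) = C / qr (n + m) ^ 7 := by
        have := qr_pos (n + m)
        field_simp
      rw [h4] at h3
      rw [← add_assoc]
      linarith
  have key2 : ∀ n m, n ≤ m → ‖u m - u n‖ ≤ 256 * C / qr n ^ 3 := by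
    intro n m hnm
    obtain ⟨d, rfl⟩ := Nat.exists_eq_add_of_le hnm
    refine (key n d).trans ?_
    have h1 : 0 ≤ 256 * C * (1 / qr (n + d) ^ 3) := by have := qr_pos (n + d); positivity
    have h2 : 256 * C / qr n ^ 3 = 256 * C * (1 / qr n ^ 3) := by ring
    rw [h2]; linarith
  have ht : Tendsto (fun n => 256 * C / qr n ^ 3) atTop (nhds 0) := by
    have := (qr_tendsto.pow 3).const_mul (256 * C)
    simpa [div_eq_mul_inv] using this
  have hc : CauchySeq u := by
    refine cauchySeq_of_le_tendsto_0' (fun n => 256 * C / qr n ^ 3) (fun n m hnm => ?_) ht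
    rw [dist_comm, dist_eq_norm]
    exact key2 n m hnm
  obtain ⟨l, hl⟩ := cauchySeq_tendsto_of_complete hc
  refine ⟨l, 256 * C, by positivity, fun n => ?_⟩
  have : Tendsto (fun m => ‖u n - u m‖) atTop (nhds ‖u n - l‖) := (tendsto_const_nhds.sub hl).norm
  refine le_of_tendsto this ?_
  filter_upwards [eventually_ge_atTop n] with m hm
  rw [norm_sub_rev]
  exact key2 n m hm

theorem qr_sum5 (N : ℕ) : ∑ n ∈ Finset.range N, 1 / qr n ^ 5 ≤ 64 := by
  have key : ∀ N, ∑ n ∈ Finset.range N, 1 / qr n ^ 5 ≤ 64 * (1 - 1 / qr N) := by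
    intro N
    induction N with
    | zero => simp [qr]
    | succ n ih =>
      rw [Finset.sum_range_succ]
      have h3 := qr_two n
      have h4 := qr_mono n
      have h5 := qr_pos n
      have h1 := qr_diff n
      set t := qr n
      set s := qr (n + 1)
      have hs : 0 < s := lt_of_lt_of_le h5 h4
      have e : 1 / t - 1 / s = (s - t) / (s * t) := by field_simp
      have h6 : 1 / (32 * t ^ 3) / ((2 * t) * t) ≤ (s - t) / (s * t) := by
        gcongr
      have h7 : 1 / (32 * t ^ 3) / ((2 * t) * t) = 1 / 64 * (1 / t ^ 5) := by
        field_simp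
        norm_num
      rw [h7, ← e] at h6
      linarith
  refine (key N).trans ?_
  have : 0 ≤ 1 / qr N := by have := qr_pos N; positivity
  linarith

theorem qr_sum5_inj (s : Finset ℤ) (g : ℤ → ℕ) (hg : Set.InjOn g s) :
    ∑ n ∈ s, 1 / qr (g n) ^ 5 ≤ 64 := by
  rw [← Finset.sum_image (f := fun m => 1 / qr m ^ 5) hg]
  refine le_trans (Finset.sum_le_sum_of_subset_of_nonneg
    (t := Finset.range ((s.image g).sup id + 1)) ?_ ?_) (qr_sum5 _)
  · intro m hm
    rw [Finset.mem_range]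
    exact Nat.lt_succ_of_le (Finset.le_sup (f := id) hm)
  · intro m _ _
    have := qr_pos m
    positivity

theorem qr_mul_ge (s t N : ℕ) (h : N ≤ s + t + 1) : qr N / 2 ≤ qr s * qr t := by
  refine le_of_pow_le_pow_left₀ (n := 4) (by norm_num)
    (by have := qr_pos s; have := qr_pos t; positivity) ?_
  rw [mul_pow, div_pow, qr_pow, qr_pow, qr_pow]
  have h1 : (N : ℝ) ≤ s + t + 1 := by exact_mod_cast h
  have h2 : (0 : ℝ) ≤ s * t := by positivity
  have h3 : (0 : ℝ) ≤ s := by positivity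
  have h4 : (0 : ℝ) ≤ t := by positivity
  nlinarith

theorem qr_term (s t N : ℕ) (h : N ≤ s + t + 1) :
    1 / qr s ^ 4 * (1 / qr t ^ 3) ≤ 2 * (1 / qr N) * (1 / qr s ^ 5 + 1 / qr t ^ 5) := by
  have hs := qr_pos s
  have ht := qr_pos t
  have hN := qr_pos N
  have h1 := qr_mul_ge s t N h
  have h2 : 1 / (qr s * qr t) ≤ 2 * (1 / qr N) := by
    have : 1 / (qr s * qr t) ≤ 1 / (qr N / 2) := by gcongr
    refine this.trans (le_of_eq ?_)
    field_simp
  have h3 : 1 / (qr s ^ 3 * qr t ^ 2) ≤ 1 / qr s ^ 5 + 1 / qr t ^ 5 := by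
    rcases le_total (qr s) (qr t) with hle | hle
    · have : 1 / (qr s ^ 3 * qr t ^ 2) ≤ 1 / (qr s ^ 3 * qr s ^ 2) := by gcongr
      have e : qr s ^ 3 * qr s ^ 2 = qr s ^ 5 := by ring
      rw [e] at this
      have : 0 ≤ 1 / qr t ^ 5 := by positivity
      linarith
    · have : 1 / (qr s ^ 3 * qr t ^ 2) ≤ 1 / (qr t ^ 3 * qr t ^ 2) := by gcongr
      have e : qr t ^ 3 * qr t ^ 2 = qr t ^ 5 := by ring
      rw [e] at this
      have : 0 ≤ 1 / qr s ^ 5 := by positivity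
      linarith
  have e : 1 / qr s ^ 4 * (1 / qr t ^ 3) = 1 / (qr s * qr t) * (1 / (qr s ^ 3 * qr t ^ 2)) := by
    field_simp
  rw [e]
  exact mul_le_mul h2 h3 (by positivity) (by positivity)

theorem qr_conv_sum (N : ℕ) (g : ℤ → ℕ) (hg : Set.InjOn g (Finset.Ico (-(N : ℤ)) N))
    (h : ∀ n ∈ Finset.Ico (-(N : ℤ)) N, N ≤ n.natAbs + g n + 1) :
    ∑ n ∈ Finset.Ico (-(N : ℤ)) N, 1 / qr n.natAbs ^ 4 * (1 / qr (g n) ^ 3) ≤ 384 * (1 / qr N) := by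
  have h1 : ∑ n ∈ Finset.Ico (-(N : ℤ)) N, 1 / qr n.natAbs ^ 5 ≤ 128 := by
    rw [← Finset.Ico_union_Ico_eq_Ico (show -(N : ℤ) ≤ 0 by omega) (show (0 : ℤ) ≤ N by omega),
      Finset.sum_union (Finset.Ico_disjoint_Ico_consecutive _ _ _)]
    have a1 := qr_sum5_inj (Finset.Ico (-(N : ℤ)) 0) Int.natAbs (by
      intro i hi j hj hij
      simp only [Finset.coe_Ico, Set.mem_Ico] at hi hj
      omega)
    have a2 := qr_sum5_inj (Finset.Ico 0 (N : ℤ)) Int.natAbs (by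
      intro i hi j hj hij
      simp only [Finset.coe_Ico, Set.mem_Ico] at hi hj
      omega)
    linarith
  have h2 := qr_sum5_inj (Finset.Ico (-(N : ℤ)) N) g hg
  have hN : 0 ≤ 2 * (1 / qr N) := by have := qr_pos N; positivity
  calc _ ≤ ∑ n ∈ Finset.Ico (-(N : ℤ)) N,
        2 * (1 / qr N) * (1 / qr n.natAbs ^ 5 + 1 / qr (g n) ^ 5) :=
        Finset.sum_le_sum fun n hn => qr_term _ _ _ (h n hn)
    _ = 2 * (1 / qr N) * (∑ n ∈ Finset.Ico (-(N : ℤ)) N, 1 / qr n.natAbs ^ 5 +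
        ∑ n ∈ Finset.Ico (-(N : ℤ)) N, 1 / qr (g n) ^ 5) := by
        rw [← Finset.mul_sum, Finset.sum_add_distrib]
    _ ≤ 2 * (1 / qr N) * (128 + 64) := by
        refine mul_le_mul_of_nonneg_left ?_ hN
        linarith
    _ = _ := by ring

theorem conv_limit (w : ℤ → ℂ) (C : ℝ) (hC : 0 ≤ C) (hw : ∀ n, ‖w n‖ ≤ C * (1 / qr n.natAbs ^ 4))
    (A B : ℕ → ℂ) (lA lB : ℂ) (CA CB : ℝ) (hCA : 0 ≤ CA) (hCB : 0 ≤ CB)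
    (hA : ∀ n, ‖A n - lA‖ ≤ CA / qr n ^ 3) (hB : ∀ n, ‖B n - lB‖ ≤ CB / qr n ^ 3)
    (P : ℂ) (hP : Tendsto (fun N : ℕ => ∑ n ∈ Finset.Ico (-(N : ℤ)) N, w n) atTop (nhds P)) :
    Tendsto (fun N : ℕ => ∑ n ∈ Finset.Ico (-(N : ℤ)) N,
      w n * (B (N + n).toNat * A (N - 1 - n).toNat)) atTop (nhds (P * (lB * lA))) := by
  have h1 := hP.mul_const (lB * lA)
  have hA' : ∀ n, ‖A n‖ ≤ ‖lA‖ + CA := by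
    intro n
    have e : ‖A n‖ ≤ ‖A n - lA‖ + ‖lA‖ := by simpa using norm_add_le (A n - lA) lA
    have h2 : CA / qr n ^ 3 ≤ CA := div_le_self hCA (one_le_pow₀ (qr_one_le n))
    linarith [hA n]
  set D : ℝ := C * (‖lA‖ + CA) * CB * 384 + C * ‖lB‖ * CA * 384 with hD
  have h2 : Tendsto (fun N : ℕ => (∑ n ∈ Finset.Ico (-(N : ℤ)) N,
      w n * (B (N + n).toNat * A (N - 1 - n).toNat)) -
      (∑ n ∈ Finset.Ico (-(N : ℤ)) N, w n) * (lB * lA)) atTop (nhds 0) := by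
    refine squeeze_zero_norm (a := fun N => D * (1 / qr N)) (fun N => ?_)
      (by simpa using qr_tendsto.const_mul D)
    have c1 := qr_conv_sum N (fun n => (N + n).toNat) (by
      intro i hi j hj hij
      simp only [Finset.coe_Ico, Set.mem_Ico] at hi hj hij
      omega) (by
      intro i hi
      simp only [Finset.mem_Ico] at hi
      omega)
    have c2 := qr_conv_sum N (fun n => (N - 1 - n).toNat) (by
      intro i hi j hj hij
      simp only [Finset.coe_Ico, Set.mem_Ico] at hi hj hij
      omega) (by
      intro i hi
      simp only [Finset.mem_Ico] at hi
      omega)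
    rw [Finset.sum_mul, ← Finset.sum_sub_distrib]
    refine (norm_sum_le _ _).trans ?_
    calc _ ≤ ∑ n ∈ Finset.Ico (-(N : ℤ)) N, (
          C * (‖lA‖ + CA) * CB * (1 / qr n.natAbs ^ 4 * (1 / qr (N + n).toNat ^ 3)) +
          C * ‖lB‖ * CA * (1 / qr n.natAbs ^ 4 * (1 / qr (N - 1 - n).toNat ^ 3))) := by
          refine Finset.sum_le_sum fun n _ => ?_
          have e : w n * (B (N + n).toNat * A (N - 1 - n).toNat) - w n * (lB * lA) =
            w n * ((B (N + n).toNat - lB) * A (N - 1 - n).toNat) +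
            w n * (lB * (A (N - 1 - n).toNat - lA)) := by ring
          rw [e]
          refine (norm_add_le _ _).trans (add_le_add ?_ ?_)
          · rw [norm_mul, norm_mul]
            calc _ ≤ C * (1 / qr n.natAbs ^ 4) * (CB / qr (N + n).toNat ^ 3 * (‖lA‖ + CA)) := by
                  refine mul_le_mul (hw n) (mul_le_mul (hB _) (hA' _) (norm_nonneg _) ?_)
                    (by positivity) ?_
                  · have := qr_pos (N + n).toNat; positivity
                  · have := qr_pos n.natAbs; positivity
              _ = _ := by ring
          · rw [norm_mul, norm_mul]
            calc _ ≤ C * (1 / qr n.natAbs ^ 4) * (‖lB‖ * (CA / qr (N - 1 - n).toNat ^ 3)) := by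
                  refine mul_le_mul (hw n) (mul_le_mul_of_nonneg_left (hA _) (norm_nonneg _))
                    (by positivity) ?_
                  have := qr_pos n.natAbs; positivity
              _ = _ := by ring
      _ = C * (‖lA‖ + CA) * CB * ∑ n ∈ Finset.Ico (-(N : ℤ)) N,
            (1 / qr n.natAbs ^ 4 * (1 / qr (N + n).toNat ^ 3)) +
          C * ‖lB‖ * CA * ∑ n ∈ Finset.Ico (-(N : ℤ)) N,
            (1 / qr n.natAbs ^ 4 * (1 / qr (N - 1 - n).toNat ^ 3)) := by
          rw [Finset.sum_add_distrib, Finset.mul_sum, Finset.mul_sum]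
      _ ≤ C * (‖lA‖ + CA) * CB * (384 * (1 / qr N)) + C * ‖lB‖ * CA * (384 * (1 / qr N)) := by
          gcongr
      _ = _ := by rw [hD]; ring
  simpa using h2.add h1

/-- Admissibility of the entries of a list (no singular denominators). -/
def GoodL (L : List (ℕ × ℂ × ℂ)) : Prop :=
  ∀ p ∈ L, 0 < p.1 ∧ ‖p.2.1‖ = 1 ∧ ∀ n : ℕ, (n : ℂ) + p.2.2 ≠ 0

theorem inv_bound (b : ℂ) : ∃ C : ℝ, 0 ≤ C ∧ ∀ n : ℕ, ‖((n : ℂ) + b)⁻¹‖ ≤ C / ((n : ℝ) + 1) := by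
  obtain ⟨M, hM⟩ := exists_nat_gt (2 * ‖b‖ + 1)
  refine ⟨2 + ∑ m ∈ Finset.range M, ((m : ℝ) + 1) * ‖((m : ℂ) + b)⁻¹‖, by positivity, fun n => ?_⟩
  rw [le_div_iff₀ (by positivity)]
  rcases lt_or_ge n M with h | h
  · have := Finset.single_le_sum (f := fun m : ℕ => ((m : ℝ) + 1) * ‖((m : ℂ) + b)⁻¹‖)
      (fun i _ => by positivity) (Finset.mem_range.2 h)
    linarith
  · have h1 : (M : ℝ) ≤ n := by exact_mod_cast h
    have h2 : (n : ℝ) - ‖b‖ ≤ ‖(n : ℂ) + b‖ := by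
      have := norm_sub_norm_le (n : ℂ) (-b)
      simpa using this
    have h3 : 0 ≤ ∑ m ∈ Finset.range M, ((m : ℝ) + 1) * ‖((m : ℂ) + b)⁻¹‖ := by positivity
    have h4 : 0 < ‖(n : ℂ) + b‖ := by linarith [norm_nonneg b]
    have h5 : ‖((n : ℂ) + b)⁻¹‖ * ((n : ℝ) + 1) ≤ 2 := by
      rw [norm_inv, inv_mul_le_iff₀ h4]
      linarith
    linarith

theorem inv_pow_bound (b : ℂ) (k : ℕ) : ∃ C : ℝ, 0 ≤ C ∧
    ∀ n : ℕ, ‖(((n : ℂ) + b) ^ k)⁻¹‖ ≤ C / ((n : ℝ) + 1) ^ k := by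
  obtain ⟨C, hC, h⟩ := inv_bound b
  refine ⟨C ^ k, by positivity, fun n => ?_⟩
  rw [← inv_pow, norm_pow, ← div_pow]
  exact pow_le_pow_left₀ (norm_nonneg _) (h n) k

theorem phT_norm (p : ℕ × ℂ × ℂ) (hx : ‖p.2.1‖ = 1) (n : ℕ) :
    ‖phT p n‖ = ‖(((n : ℂ) + p.2.2) ^ p.1)⁻¹‖ := by
  rw [phT, div_eq_mul_inv, norm_mul, norm_zpow, hx, one_zpow, one_mul]
  simp

theorem phT_bound (p : ℕ × ℂ × ℂ) (hx : ‖p.2.1‖ = 1) (m : ℕ) (hm : m ≤ p.1) :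
    ∃ C : ℝ, 0 ≤ C ∧ ∀ n : ℕ, ‖phT p n‖ ≤ C / (qr n ^ 4) ^ m := by
  obtain ⟨C, hC, h⟩ := inv_pow_bound p.2.2 p.1
  refine ⟨C, hC, fun n => ?_⟩
  rw [phT_norm p hx, qr_pow]
  refine (h n).trans ?_
  have : (1 : ℝ) ≤ (n : ℝ) + 1 := by
    have : (0 : ℝ) ≤ n := by positivity
    linarith
  gcongr

theorem cmhzP_snoc (L : List (ℕ × ℂ × ℂ)) (p : ℕ × ℂ × ℂ) (n : ℕ) :
    cmhzP (L ++ [p]) (n + 1) = cmhzP (L ++ [p]) n + phT p n * cmhzP L n := by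
  rw [cmhzP_eq, cmhzP_eq, cmhzP_eq, List.map_append, List.map_cons, List.map_nil, itS_snoc,
    itS_snoc]
  rw [← Finset.Ico_union_Ico_eq_Ico (show (0 : ℤ) ≤ n by omega)
    (show (n : ℤ) ≤ ((n + 1 : ℕ) : ℤ) by omega),
      Finset.sum_union (Finset.Ico_disjoint_Ico_consecutive _ _ _)]
  congr 1
  have : Finset.Ico (n : ℤ) ((n + 1 : ℕ) : ℤ) = {(n : ℤ)} := by
    ext m
    simp only [Finset.mem_Ico, Finset.mem_singleton]
    omega
  rw [this, Finset.sum_singleton]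

theorem cmhzP_nil (n : ℕ) : cmhzP [] n = 1 := by
  rw [cmhzP_eq]; rfl

theorem GoodL.left {L M : List (ℕ × ℂ × ℂ)} (h : GoodL (L ++ M)) : GoodL L :=
  fun p hp => h p (List.mem_append_left _ hp)

theorem cmhzP_step_of_growth (L : List (ℕ × ℂ × ℂ)) (p : ℕ × ℂ × ℂ) (hp : 0 < p.1)
    (hx : ‖p.2.1‖ = 1) (C : ℝ) (hC : 0 ≤ C) (h : ∀ n, ‖cmhzP L n‖ ≤ C * qr n) :
    ∃ C', 0 ≤ C' ∧ ∀ n, ‖cmhzP (L ++ [p]) (n + 1) - cmhzP (L ++ [p]) n‖ ≤ C' / qr n ^ 3 := by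
  obtain ⟨D, hD, hph⟩ := phT_bound p hx 1 hp
  refine ⟨D * C, by positivity, fun n => ?_⟩
  rw [cmhzP_snoc, add_sub_cancel_left, norm_mul]
  have hq := qr_pos n
  calc _ ≤ D / (qr n ^ 4) ^ 1 * (C * qr n) :=
        mul_le_mul (hph n) (h n) (norm_nonneg _) (by positivity)
    _ = _ := by field_simp

theorem cmhzP_growth (L : List (ℕ × ℂ × ℂ)) (hL : GoodL L) :
    ∃ C, 0 ≤ C ∧ ∀ n, ‖cmhzP L n‖ ≤ C * qr n := by
  induction L using List.reverseRecOn with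
  | nil =>
    refine ⟨1, by norm_num, fun n => ?_⟩
    rw [cmhzP_nil, norm_one, one_mul]
    exact qr_one_le n
  | append_singleton L p ih =>
    obtain ⟨C, hC, h⟩ := ih hL.left
    have hp := hL p (by simp)
    obtain ⟨C', hC', h'⟩ := cmhzP_step_of_growth L p hp.1 hp.2.1 C hC h
    exact qr_rate_growth _ C' hC' h'

theorem cmhzP_step (L : List (ℕ × ℂ × ℂ)) (hL : GoodL L) :
    ∃ C, 0 ≤ C ∧ ∀ n, ‖cmhzP L (n + 1) - cmhzP L n‖ ≤ C / qr n ^ 3 := by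
  induction L using List.reverseRecOn with
  | nil => exact ⟨0, le_rfl, fun n => by simp [cmhzP_nil]⟩
  | append_singleton L p _ =>
    obtain ⟨C, hC, h⟩ := cmhzP_growth L hL.left
    have hp := hL p (by simp)
    exact cmhzP_step_of_growth L p hp.1 hp.2.1 C hC h

theorem cmhzP_rate (L : List (ℕ × ℂ × ℂ)) (hL : GoodL L)
    (hlast : ∀ p, L.getLast? = some p → ¬ (p.1 = 1 ∧ p.2.1 = 1)) :
    ∃ l C, 0 ≤ C ∧ ∀ n, ‖cmhzP L n - l‖ ≤ C / qr n ^ 3 := by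
  rcases List.eq_nil_or_concat L with rfl | ⟨L', p, rfl⟩
  · exact ⟨1, 0, le_rfl, fun n => by simp [cmhzP_nil]⟩
  · simp only [List.concat_eq_append] at *
    have hp := hL p (by simp)
    have hne := hlast p (by simp)
    obtain ⟨C, hC, h⟩ := cmhzP_growth L' hL.left
    by_cases hk : 2 ≤ p.1
    · obtain ⟨D, hD, hph⟩ := phT_bound p hp.2.1 2 hk
      refine qr_rate_conv _ (D * C) (by positivity) fun n => ?_
      rw [cmhzP_snoc, add_sub_cancel_left, norm_mul]
      have hq := qr_pos n
      calc _ ≤ D / (qr n ^ 4) ^ 2 * (C * qr n) :=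
            mul_le_mul (hph n) (h n) (norm_nonneg _) (by positivity)
        _ = _ := by field_simp
    · have hk1 : p.1 = 1 := by have := hp.1; omega
      obtain ⟨k, x, b⟩ := p
      simp only at hk1 hp hne
      subst hk1
      have hx1 : x ≠ 1 := fun e => hne ⟨rfl, e⟩
      have hx0 : x - 1 ≠ 0 := sub_ne_zero.2 hx1
      have hxz : x ≠ 0 := by
        rintro rfl
        simp at hp
      obtain ⟨E, hE, hstep⟩ := cmhzP_step L' hL.left
      obtain ⟨D, hD, hinv⟩ := inv_bound b
      set P := cmhzP L' with hP
      set G : ℕ → ℂ := fun n => P n * ((n : ℂ) + b)⁻¹ with hG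
      set H : ℕ → ℂ := fun n => x ^ (n + 1) * G n / (x - 1) with hH
      set u : ℕ → ℂ := fun n => cmhzP (L' ++ [(1, x, b)]) n - H n with hu
      have hGn : ∀ n, ‖G n‖ ≤ C * D / qr n ^ 3 := by
        intro n
        have hq := qr_pos n
        rw [hG]
        simp only [norm_mul]
        calc _ ≤ C * qr n * (D / ((n : ℝ) + 1)) :=
              mul_le_mul (h n) (hinv n) (norm_nonneg _) (by positivity)
          _ = _ := by rw [← qr_pow]; field_simp
      have hinv1 : ∀ n : ℕ, ‖(((n + 1 : ℕ) : ℂ) + b)⁻¹‖ ≤ D / ((n : ℝ) + 1) := by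
        intro n
        refine (hinv (n + 1)).trans ?_
        gcongr
        linarith
      have hGd : ∀ n, ‖G (n + 1) - G n‖ ≤ (E * D + C * (D * D)) / qr n ^ 7 := by
        intro n
        have hq := qr_pos n
        have e : G (n + 1) - G n = (P (n + 1) - P n) * (((n + 1 : ℕ) : ℂ) + b)⁻¹ -
            P n * (((n : ℂ) + b)⁻¹ * (((n + 1 : ℕ) : ℂ) + b)⁻¹) := by
          have h1 := hp.2.2 n
          have h2 := hp.2.2 (n + 1)
          simp only [hG]
          push_cast at h2 ⊢
          field_simp
          ring
        rw [e]
        refine (norm_sub_le _ _).trans ?_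
        rw [norm_mul, norm_mul, norm_mul]
        calc _ ≤ E / qr n ^ 3 * (D / ((n : ℝ) + 1)) +
              C * qr n * (D / ((n : ℝ) + 1) * (D / ((n : ℝ) + 1))) := by
              refine add_le_add (mul_le_mul (hstep n) (hinv1 n) (norm_nonneg _) (by positivity))
                (mul_le_mul (h n) (mul_le_mul (hinv n) (hinv1 n) (norm_nonneg _) (by positivity))
                (by positivity) (by positivity))
          _ = _ := by rw [← qr_pow]; field_simp
      have hxn : ‖x‖ = 1 := hp.2.1
      obtain ⟨l, C', hC', hl⟩ := qr_rate_conv u ((E * D + C * (D * D)) * ‖(x - 1)⁻¹‖)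
        (by positivity) (by
          intro n
          have e : u (n + 1) - u n = - (x ^ (n + 2) * ((G (n + 1) - G n) * (x - 1)⁻¹)) := by
            simp only [hu, hH]
            rw [cmhzP_snoc, phT]
            have e1 : x ^ ((n : ℤ) + 1) = x ^ (n + 1) := by exact_mod_cast rfl
            have e2 : x ^ ((n : ℤ) + 1) / (((n : ℤ) : ℂ) + b) ^ 1 * cmhzP L' n
              = x ^ (n + 1) * G n := by
              rw [e1, hG, hP]
              simp only [pow_one, Int.cast_natCast]
              ring
            simp only
            rw [e2]
            field_simp
            ring
          rw [e, norm_neg, norm_mul, norm_mul, norm_pow, hxn, one_pow, one_mul]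
          calc _ ≤ (E * D + C * (D * D)) / qr n ^ 7 * ‖(x - 1)⁻¹‖ :=
                mul_le_mul_of_nonneg_right (hGd n) (norm_nonneg _)
            _ = _ := by ring)
      refine ⟨l, C' + C * D * ‖(x - 1)⁻¹‖, by positivity, fun n => ?_⟩
      have e : cmhzP (L' ++ [(1, x, b)]) n - l = (u n - l) + H n := by
        simp only [hu]; ring
      rw [e]
      refine (norm_add_le _ _).trans ?_
      have e2 : ‖H n‖ ≤ C * D / qr n ^ 3 * ‖(x - 1)⁻¹‖ := by
        simp only [hH]
        rw [div_eq_mul_inv, norm_mul, norm_mul, norm_pow, hxn, one_pow, one_mul]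
        exact mul_le_mul_of_nonneg_right (hGn n) (norm_nonneg _)
      calc _ ≤ C' / qr n ^ 3 + C * D / qr n ^ 3 * ‖(x - 1)⁻¹‖ := add_le_add (hl n) e2
        _ = _ := by ring

theorem tendsto_of_rate (u : ℕ → ℂ) (l : ℂ) (C : ℝ) (h : ∀ n, ‖u n - l‖ ≤ C / qr n ^ 3) :
    Tendsto u atTop (nhds l) := by
  have ht : Tendsto (fun n => C / qr n ^ 3) atTop (nhds 0) := by
    have := (qr_tendsto.pow 3).const_mul C
    simpa [div_eq_mul_inv] using this
  have := squeeze_zero_norm h ht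
  simpa using this.add_const l

/-- The domain for partial fractions. -/
def pfU (r : ℕ) : Set (Fin r → ℂ) := {y | (∀ j, y j ≠ 0) ∧ Function.Injective y}

/-- Elementary partial fraction term. -/
noncomputable def pfT {r : ℕ} (i : Fin r) (l : ℕ) (K : Fin r → ℕ) (y : Fin r → ℂ) : ℂ :=
  ((y i) ^ l)⁻¹ * ∏ j ∈ Finset.univ.erase i, ((y j - y i) ^ (K j))⁻¹

/-- Rational span of partial fraction terms with exponents at least `k`. -/
noncomputable def pfV {r : ℕ} (k : Fin r → ℕ) : Submodule ℚ ((Fin r → ℂ) → ℂ) :=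
  Submodule.span ℚ {f | ∃ i l K, 0 < l ∧ (∀ j, j ≠ i → k j ≤ K j) ∧ f = pfT i l K}

theorem pf_base {r : ℕ} (hr : 0 < r) (y : Fin r → ℂ) (hy : y ∈ pfU r) :
    ∏ j, (y j)⁻¹ = ∑ i, pfT i 1 (fun _ => 1) y := by
  have h := Lagrange.sum_basis (s := (Finset.univ : Finset (Fin r))) (v := y) hy.2.injOn
    ⟨⟨0, hr⟩, Finset.mem_univ _⟩
  have h2 := congrArg (Polynomial.eval 0) h
  rw [Polynomial.eval_finsetSum, Polynomial.eval_one] at h2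
  calc ∏ j, (y j)⁻¹ = (∏ j, (y j)⁻¹) * 1 := by ring
    _ = ∑ i, (∏ j, (y j)⁻¹) * Polynomial.eval 0 (Lagrange.basis Finset.univ y i) := by
        rw [← h2, Finset.mul_sum]
    _ = _ := by
      refine Finset.sum_congr rfl fun i _ => ?_
      rw [Lagrange.basis, Polynomial.eval_prod, ← Finset.mul_prod_erase _ _ (Finset.mem_univ i),
        pfT, mul_assoc, ← Finset.prod_mul_distrib, pow_one]
      congr 1
      refine Finset.prod_congr rfl fun j hj => ?_
      have hji : y j - y i ≠ 0 := sub_ne_zero.2 fun e => (Finset.ne_of_mem_erase hj) (hy.2 e)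
      have hij : y i - y j ≠ 0 := sub_ne_zero.2 fun e => (Finset.ne_of_mem_erase hj) (hy.2 e.symm)
      have := hy.1 j
      simp only [Lagrange.basisDivisor, Polynomial.eval_mul, Polynomial.eval_C,
        Polynomial.eval_sub, Polynomial.eval_X, pow_one]
      field_simp
      ring

theorem hasDerivAt_inv_pow (c : ℂ) (m : ℕ) (s : ℂ) (h : s - c ≠ 0) :
    HasDerivAt (fun s : ℂ => ((s - c) ^ m)⁻¹) (-(m : ℂ) * ((s - c) ^ (m + 1))⁻¹) s := by
  have h1 := (((hasDerivAt_id s).sub_const c).pow m).inv (pow_ne_zero m h)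
  refine h1.congr_deriv ?_
  simp only [id]
  rcases m with _ | m
  · simp
  · simp only [Nat.add_sub_cancel, Pi.pow_apply]
    field_simp
    ring

theorem hasDerivAt_inv_pow' (c : ℂ) (m : ℕ) (s : ℂ) (h : c - s ≠ 0) :
    HasDerivAt (fun s : ℂ => ((c - s) ^ m)⁻¹) ((m : ℂ) * ((c - s) ^ (m + 1))⁻¹) s := by
  have h1 := (((hasDerivAt_id s).const_sub c).pow m).inv (pow_ne_zero m h)
  refine h1.congr_deriv ?_
  simp only [id]
  rcases m with _ | m
  · simp
  · simp only [Nat.add_sub_cancel, Pi.pow_apply]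
    field_simp
    ring

theorem pf_deriv_term_ne {r : ℕ} (i p : Fin r) (hp : p ≠ i) (l : ℕ) (K : Fin r → ℕ)
    (y : Fin r → ℂ) (hy : y ∈ pfU r) :
    HasDerivAt (fun s => pfT i l K (Function.update y p s))
      (-(K p : ℂ) * pfT i l (Function.update K p (K p + 1)) y) (y p) := by
  have hpm : p ∈ Finset.univ.erase i := Finset.mem_erase.2 ⟨hp, Finset.mem_univ _⟩
  have e1 : (fun s => pfT i l K (Function.update y p s)) = fun s =>
      (((y i) ^ l)⁻¹ * ∏ j ∈ (Finset.univ.erase i).erase p, ((y j - y i) ^ (K j))⁻¹) *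
        ((s - y i) ^ (K p))⁻¹ := by
    funext s
    rw [pfT, ← Finset.mul_prod_erase _ _ hpm, Function.update_self,
      Function.update_of_ne hp.symm, Finset.prod_congr rfl (g := fun j => ((y j - y i) ^ (K j))⁻¹)]
    · ring
    · intro j hj
      rw [Function.update_of_ne (Finset.ne_of_mem_erase hj)]
  rw [e1]
  refine ((hasDerivAt_inv_pow (y i) (K p) (y p)
    (sub_ne_zero.2 fun e => hp (hy.2 e))).const_mul _).congr_deriv ?_
  rw [pfT, ← Finset.mul_prod_erase _ _ hpm, Function.update_self,
      Finset.prod_congr rfl (g := fun j => ((y j - y i) ^ (K j))⁻¹)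
      (f := fun j => ((y j - y i) ^ (Function.update K p (K p + 1) j))⁻¹)]
  · ring
  · intro j hj
    rw [Function.update_of_ne (Finset.ne_of_mem_erase hj)]

theorem pf_deriv_term_eq {r : ℕ} (i : Fin r) (l : ℕ) (K : Fin r → ℕ)
    (y : Fin r → ℂ) (hy : y ∈ pfU r) :
    HasDerivAt (fun s => pfT i l K (Function.update y i s))
      (-(l : ℂ) * pfT i (l + 1) K y +
        ∑ j ∈ Finset.univ.erase i, (K j : ℂ) * pfT i l (Function.update K j (K j + 1)) y) (y i) := by
  have e1 : (fun s => pfT i l K (Function.update y i s)) = fun s =>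
      ((s - 0) ^ l)⁻¹ * ∏ j ∈ Finset.univ.erase i, ((y j - s) ^ (K j))⁻¹ := by
    funext s
    rw [pfT, Function.update_self, sub_zero]
    congr 1
    refine Finset.prod_congr rfl fun j hj => ?_
    rw [Function.update_of_ne (Finset.ne_of_mem_erase hj)]
  rw [e1]
  have hne : ∀ j ∈ Finset.univ.erase i, y j - y i ≠ 0 := fun j hj =>
    sub_ne_zero.2 fun e => (Finset.ne_of_mem_erase hj) (hy.2 e)
  have d1 := hasDerivAt_inv_pow 0 l (y i) (by simpa using hy.1 i)
  have d2 := HasDerivAt.fun_finsetProd (u := Finset.univ.erase i)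
    (f := fun j s => ((y j - s) ^ (K j))⁻¹) (x := y i)
    (f' := fun j => (K j : ℂ) * ((y j - y i) ^ (K j + 1))⁻¹)
    (fun j hj => hasDerivAt_inv_pow' (y j) (K j) (y i) (hne j hj))
  refine (d1.mul d2).congr_deriv ?_
  simp only [sub_zero]
  congr 1
  · rw [pfT]; ring
  · rw [Finset.mul_sum]
    refine Finset.sum_congr rfl fun j hj => ?_
    rw [pfT, ← Finset.mul_prod_erase _ _ hj, Function.update_self, smul_eq_mul,
      Finset.prod_congr rfl (g := fun j => ((y j - y i) ^ (K j))⁻¹)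
        (s₂ := (Finset.univ.erase i).erase j)]
    · rw [Finset.prod_congr rfl (g := fun b => ((y b - y i) ^ (Function.update K j (K j + 1) b))⁻¹)
        (s₂ := (Finset.univ.erase i).erase j)]
      · ring
      · intro b hb
        rw [Function.update_of_ne (Finset.ne_of_mem_erase hb)]
    · intro b hb
      rfl

theorem pf_deriv {r : ℕ} (k : Fin r → ℕ) (p : Fin r) (f : (Fin r → ℂ) → ℂ) (hf : f ∈ pfV k) :
    ∃ g ∈ pfV (Function.update k p (k p + 1)), ∀ y ∈ pfU r,
      HasDerivAt (fun s => f (Function.update y p s)) (g y) (y p) := by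
  induction hf using Submodule.span_induction with
  | mem f hf =>
    obtain ⟨i, l, K, hl, hK, rfl⟩ := hf
    by_cases hp : p = i
    · subst hp
      refine ⟨(-(l : ℚ)) • pfT p (l + 1) K +
        ∑ j ∈ Finset.univ.erase p, (K j : ℚ) • pfT p l (Function.update K j (K j + 1)), ?_, ?_⟩
      · refine Submodule.add_mem _ (Submodule.smul_mem _ _ (Submodule.subset_span
          ⟨p, l + 1, K, by omega, fun j hj => ?_, rfl⟩)) (Submodule.sum_mem _ fun b hb =>
          Submodule.smul_mem _ _ (Submodule.subset_span ⟨p, l, _, hl, fun j hj => ?_, rfl⟩))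
        · rw [Function.update_of_ne hj]; exact hK j hj
        · rw [Function.update_of_ne hj]
          refine (hK j hj).trans ?_
          by_cases h : j = b
          · subst h; simp
          · rw [Function.update_of_ne h]
      · intro y hy
        refine (pf_deriv_term_eq p l K y hy).congr_deriv ?_
        simp [Rat.smul_def]
    · refine ⟨(-(K p : ℚ)) • pfT i l (Function.update K p (K p + 1)), ?_, ?_⟩
      · refine Submodule.smul_mem _ _ (Submodule.subset_span ⟨i, l, _, hl, fun j hj => ?_, rfl⟩)
        by_cases h : j = p
        · subst h; simpa using hK j hj
        · rw [Function.update_of_ne h, Function.update_of_ne h]; exact hK j hj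
      · intro y hy
        refine (pf_deriv_term_ne i p hp l K y hy).congr_deriv ?_
        simp [Rat.smul_def]
  | zero => exact ⟨0, Submodule.zero_mem _, fun y _ => by simpa using hasDerivAt_const _ _⟩
  | add f g _ _ hf hg =>
    obtain ⟨f', hf', hf⟩ := hf
    obtain ⟨g', hg', hg⟩ := hg
    exact ⟨f' + g', Submodule.add_mem _ hf' hg', fun y hy => (hf y hy).add (hg y hy)⟩
  | smul c f _ hf =>
    obtain ⟨f', hf', hf⟩ := hf
    refine ⟨c • f', Submodule.smul_mem _ _ hf', fun y hy => ?_⟩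
    have := (hf y hy).const_mul (c : ℂ)
    simpa [Rat.smul_def] using this

theorem pfU_update {r : ℕ} (y : Fin r → ℂ) (hy : y ∈ pfU r) (p : Fin r) :
    ∀ᶠ s in nhds (y p), Function.update y p s ∈ pfU r := by
  have h1 : ∀ᶠ s in nhds (y p), s ≠ 0 := isOpen_ne.mem_nhds (hy.1 p)
  have h2 : ∀ᶠ s in nhds (y p), ∀ j, j ≠ p → s ≠ y j := by
    rw [Filter.eventually_all]
    intro j
    by_cases h : j = p
    · simp [h]
    · have : ∀ᶠ s in nhds (y p), s ≠ y j := isOpen_ne.mem_nhds fun e => h (hy.2 e.symm)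
      filter_upwards [this] with s hs _ using hs
  filter_upwards [h1, h2] with s h1 h2
  refine ⟨fun j => ?_, fun i j hij => ?_⟩
  · by_cases h : j = p
    · subst h; simpa
    · rw [Function.update_of_ne h]; exact hy.1 j
  · by_cases hi : i = p <;> by_cases hj : j = p
    · rw [hi, hj]
    · subst hi
      rw [Function.update_self, Function.update_of_ne hj] at hij
      exact absurd hij (h2 j hj)
    · subst hj
      rw [Function.update_self, Function.update_of_ne hi] at hij
      exact absurd hij.symm (h2 i hi)
    · rw [Function.update_of_ne hj, Function.update_of_ne hi] at hij
      exact hy.2 hij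

theorem pf_step {r : ℕ} (k : Fin r → ℕ) (p : Fin r) (hkp : 0 < k p)
    (h : ∃ f ∈ pfV k, ∀ y ∈ pfU r, ∏ j, ((y j) ^ (k j))⁻¹ = f y) :
    ∃ f ∈ pfV (Function.update k p (k p + 1)), ∀ y ∈ pfU r,
      ∏ j, ((y j) ^ (Function.update k p (k p + 1) j))⁻¹ = f y := by
  obtain ⟨f, hf, hfy⟩ := h
  obtain ⟨g, hg, hgy⟩ := pf_deriv k p f hf
  refine ⟨(-(k p : ℚ))⁻¹ • g, Submodule.smul_mem _ _ hg, fun y hy => ?_⟩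
  have h1 := hgy y hy
  have h2 : HasDerivAt (fun s => f (Function.update y p s))
      (-(k p : ℂ) * ∏ j, ((y j) ^ (Function.update k p (k p + 1) j))⁻¹) (y p) := by
    have e1 : (fun s => f (Function.update y p s)) =ᶠ[nhds (y p)] fun s =>
        (∏ j ∈ Finset.univ.erase p, ((y j) ^ (k j))⁻¹) * ((s - 0) ^ (k p))⁻¹ := by
      filter_upwards [pfU_update y hy p] with s hs
      rw [← hfy _ hs, ← Finset.mul_prod_erase _ _ (Finset.mem_univ p), Function.update_self,
        Finset.prod_congr rfl (g := fun j => ((y j) ^ (k j))⁻¹), sub_zero]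
      · ring
      · intro j hj
        rw [Function.update_of_ne (Finset.ne_of_mem_erase hj)]
    refine HasDerivAt.congr_of_eventuallyEq ?_ e1
    refine ((hasDerivAt_inv_pow 0 (k p) (y p) (by simpa using hy.1 p)).const_mul _).congr_deriv ?_
    rw [← Finset.mul_prod_erase _ _ (Finset.mem_univ p), Function.update_self,
        Finset.prod_congr rfl (g := fun j => ((y j) ^ (k j))⁻¹)
          (s₂ := Finset.univ.erase p) (f := fun j => (y j ^ (Function.update k p (k p + 1) j))⁻¹),
        sub_zero]
    · ring
    · intro j hj
      rw [Function.update_of_ne (Finset.ne_of_mem_erase hj)]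
  have h3 := h1.unique h2
  have : (k p : ℂ) ≠ 0 := by exact_mod_cast hkp.ne'
  simp only [Pi.smul_apply, Rat.smul_def, h3]
  push_cast
  field_simp

theorem pf_main {r : ℕ} (hr : 0 < r) : ∀ (n : ℕ) (k : Fin r → ℕ), (∀ j, 0 < k j) →
    ∑ j, (k j - 1) = n →
    ∃ f ∈ pfV k, ∀ y ∈ pfU r, ∏ j, ((y j) ^ (k j))⁻¹ = f y := by
  intro n
  induction n with
  | zero =>
    intro k hk hs
    have hk1 : k = fun _ => 1 := by
      funext j
      rw [Finset.sum_eq_zero_iff] at hs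
      have := hs j (Finset.mem_univ j)
      have := hk j
      omega
    subst hk1
    refine ⟨∑ i, pfT i 1 (fun _ => 1), Submodule.sum_mem _ fun i _ => Submodule.subset_span
      ⟨i, 1, _, one_pos, fun _ _ => le_rfl, rfl⟩, fun y hy => ?_⟩
    simp only [pow_one]
    rw [pf_base hr y hy, Finset.sum_apply]
  | succ n ih =>
    intro k hk hs
    obtain ⟨p, hp⟩ : ∃ p, 2 ≤ k p := by
      by_contra! hcon
      have : ∑ j, (k j - 1) = 0 := Finset.sum_eq_zero fun j _ => by have := hcon j; omega
      omega
    have hkk : k = Function.update (Function.update k p (k p - 1)) p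
        ((Function.update k p (k p - 1)) p + 1) := by
      funext j
      by_cases h : j = p
      · subst h; simp; omega
      · simp [h]
    rw [hkk]
    refine pf_step _ p (by simp; omega) (ih _ (fun j => ?_) ?_)
    · by_cases h : j = p
      · subst h; simp; omega
      · simp [h, hk]
    · rw [← Finset.add_sum_erase _ _ (Finset.mem_univ p)] at hs ⊢
      rw [Function.update_self, Finset.sum_congr rfl (g := fun j => k j - 1)]
      · omega
      · intro j hj
        rw [Function.update_of_ne (Finset.ne_of_mem_erase hj)]

/-- Reflection of a triple. -/
noncomputable def reflT (p : ℕ × ℂ × ℂ) : ℕ × ℂ × ℂ := (p.1, p.2.1⁻¹, 1 - p.2.2)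

theorem phT_reflect (p : ℕ × ℂ × ℂ) (hx : p.2.1 ≠ 0) (n : ℤ) :
    phT p (-1 - n) = (p.2.1 * (-1) ^ p.1) * phT (reflT p) n := by
  obtain ⟨k, x, b⟩ := p
  simp only [phT, reflT] at *
  have e1 : x ^ (-1 - n + 1) = x * x⁻¹ ^ (n + 1) := by
    rw [inv_zpow', show -1 - n + 1 = 1 + -(n + 1) by ring, zpow_add₀ hx, zpow_one]
  have e2 : (((-1 - n : ℤ) : ℂ) + b) ^ k = (-1) ^ k * ((n : ℂ) + (1 - b)) ^ k := by
    rw [← mul_pow]; push_cast; ring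
  have e3 : ((-1 : ℂ) ^ k)⁻¹ = (-1) ^ k := by
    rw [← inv_pow]; norm_num
  rw [e1, e2, div_eq_mul_inv, div_eq_mul_inv, mul_inv, e3]
  ring

theorem itS_neg (L : List (ℕ × ℂ × ℂ)) (hL : ∀ p ∈ L, p.2.1 ≠ 0) (N : ℕ) :
    itS (L.map phT) (-(N : ℤ)) 0 =
      (L.map fun p => p.2.1 * (-1) ^ p.1).prod * cmhzP (L.reverse.map reflT) N := by
  rw [itS_reflect (-1), cmhzP_eq, ← List.map_reverse, List.map_map, List.map_map]
  rw [itS_scale (J := L.reverse) (g := phT ∘ reflT) (c := fun p => p.2.1 * (-1) ^ p.1)]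
  · congr 1
    · exact ((List.reverse_perm L).map _).prod_eq
    · norm_num
  · intro p hp n
    simp only [Function.comp]
    exact phT_reflect p (hL p (List.mem_reverse.1 hp)) n

theorem itS_tangent (L : List (ℕ × ℂ × ℂ)) (hL : ∀ p ∈ L, p.2.1 ≠ 0) (N : ℕ) :
    itS (L.map phT) (-(N : ℤ)) N = ∑ t ∈ Finset.range (L.length + 1),
      ((L.take t).map fun p => p.2.1 * (-1) ^ p.1).prod * cmhzP ((L.take t).reverse.map reflT) N
        * cmhzP (L.drop t) N := by
  rw [itS_split _ _ _ 0 (by omega) (by omega), List.length_map]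
  refine Finset.sum_congr rfl fun t _ => ?_
  rw [← List.map_take, ← List.map_drop, itS_neg _ (fun p hp => hL p (List.mem_of_mem_take hp)),
    cmhzP_eq (L.drop t)]

theorem prod_map_zpow' {ι : Type} (J : List ι) (x : ι → ℂ) (m : ℤ) :
    (J.map fun j => x j ^ m).prod = (J.map x).prod ^ m := by
  induction J with
  | nil => simp
  | cons j J ih => simp [ih, mul_zpow]

theorem finRange_split {r : ℕ} (i : Fin r) : List.finRange r =
    (List.finRange r).take i ++ i :: (List.finRange r).drop (i + 1) := by
  have h : (i : ℕ) < (List.finRange r).length := by simp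
  conv_lhs => rw [← List.take_append_drop i (List.finRange r)]
  rw [List.drop_eq_getElem_cons h]
  simp

theorem mem_take_finRange {r : ℕ} (i : ℕ) (j : Fin r) (h : j ∈ (List.finRange r).take i) :
    (j : ℕ) < i := by
  rw [List.mem_take_iff_getElem] at h
  obtain ⟨t, ht, rfl⟩ := h
  simp at ht ⊢
  omega

theorem mem_drop_finRange {r : ℕ} (i : ℕ) (j : Fin r) (h : j ∈ (List.finRange r).drop i) :
    i ≤ (j : ℕ) := by
  rw [List.mem_drop_iff_getElem] at h
  obtain ⟨t, ht, rfl⟩ := h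
  simp

theorem head_take_finRange {r : ℕ} (i : ℕ) (j : Fin r)
    (h : ((List.finRange r).take i).head? = some j) : (j : ℕ) = 0 := by
  rw [List.head?_eq_getElem?, List.getElem?_eq_some_iff] at h
  obtain ⟨_, rfl⟩ := h
  simp

theorem last_drop_finRange {r : ℕ} (i : ℕ) (j : Fin r)
    (h : ((List.finRange r).drop i).getLast? = some j) : (j : ℕ) + 1 = r := by
  rw [List.getLast?_drop] at h
  split_ifs at h
  rw [List.getLast?_eq_getElem?, List.getElem?_eq_some_iff] at h
  obtain ⟨h1, rfl⟩ := h
  simp at h1 ⊢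
  omega

theorem term_sum {r : ℕ} (x a : Fin r → ℂ) (hx : ∀ j, x j ≠ 0) (i : Fin r) (l : ℕ)
    (K : Fin r → ℕ) (N : ℕ) :
    ∑ n ∈ smT r (-(N : ℤ)) N, (∏ j, x j ^ (n j + 1)) * pfT i l K (fun j => (n j : ℂ) + a j) =
    (((List.finRange r).take i).map fun j => (-1 : ℂ) ^ K j).prod *
    ∑ m ∈ Finset.Ico (-(N : ℤ)) N, phT (l, ∏ j, x j, a i) m *
      (cmhzP (((List.finRange r).take i).reverse.map
          fun j => (K j, (x j)⁻¹, 1 + a i - a j)) (N + m).toNat *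
       cmhzP (((List.finRange r).drop (i + 1)).map
          fun j => (K j, x j, 1 + a j - a i)) (N - 1 - m).toNat) := by
  set F : ℤ → Fin r → ℤ → ℂ := fun m j n =>
    if j = i then (if n = m then x i ^ (m + 1) * (((m : ℂ) + a i) ^ l)⁻¹ else 0)
    else x j ^ (n + 1) * (((n : ℂ) + a j - (m + a i)) ^ K j)⁻¹ with hF
  have e1 : ∀ n ∈ smT r (-(N : ℤ)) N,
      (∏ j, x j ^ (n j + 1)) * pfT i l K (fun j => (n j : ℂ) + a j) =
      ∑ m ∈ Finset.Ico (-(N : ℤ)) N, ∏ j, F m j (n j) := by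
    intro n hn
    rw [mem_smT] at hn
    rw [Finset.sum_eq_single (n i)]
    · rw [pfT, ← Finset.mul_prod_erase _ _ (Finset.mem_univ i),
        ← Finset.mul_prod_erase (a := i) _ (fun j => F (n i) j (n j)) (Finset.mem_univ i)]
      have : F (n i) i (n i) = x i ^ (n i + 1) * (((n i : ℂ) + a i) ^ l)⁻¹ := by simp [hF]
      rw [this]
      have h2 : ∏ j ∈ Finset.univ.erase i, F (n i) j (n j) =
          (∏ j ∈ Finset.univ.erase i, x j ^ (n j + 1)) *
          ∏ j ∈ Finset.univ.erase i, (((n j : ℂ) + a j - (n i + a i)) ^ K j)⁻¹ := by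
        rw [← Finset.prod_mul_distrib]
        refine Finset.prod_congr rfl fun j hj => ?_
        simp [hF, Finset.ne_of_mem_erase hj]
      rw [h2]
      ring
    · intro m _ hm
      refine Finset.prod_eq_zero (Finset.mem_univ i) ?_
      simp [hF, hm.symm]
    · intro h
      exact absurd (Finset.mem_Ico.2 (hn.1 i)) h
  rw [Finset.sum_congr rfl e1, Finset.sum_comm, Finset.mul_sum]
  refine Finset.sum_congr rfl fun m hm => ?_
  have hm' := Finset.mem_Ico.1 hm
  rw [sum_smT, List.ofFn_eq_map, finRange_split i, List.map_append, List.map_cons, itS_mid,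
    ← finRange_split i]
  rw [Finset.sum_eq_single m]
  rotate_left
  · intro n _ hn
    simp [hF, hn]
  · intro h; exact absurd hm h
  have eA : itS (((List.finRange r).drop (i + 1)).map (F m)) (m + 1) N =
      (((List.finRange r).drop (i + 1)).map x).prod ^ (m + 1) *
      cmhzP (((List.finRange r).drop (i + 1)).map
          fun j => (K j, x j, 1 + a j - a i)) (N - 1 - m).toNat := by
    rw [itS_shift (m + 1), List.map_map, cmhzP_eq, List.map_map, ← prod_map_zpow']
    rw [itS_scale (g := phT ∘ fun j => (K j, x j, 1 + a j - a i)) (c := fun j => x j ^ (m + 1))]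
    · congr 2
      · ring
      · rw [Int.toNat_of_nonneg (by omega)]; ring
    · intro j hj n
      have hji : j ≠ i := by
        have := mem_drop_finRange _ _ hj
        rintro rfl
        omega
      simp only [Function.comp, hF, hji, if_false, phT]
      rw [show m + 1 + n + 1 = (m + 1) + (n + 1) by ring, zpow_add₀ (hx j), div_eq_mul_inv]
      push_cast
      rw [show (m : ℂ) + 1 + n + a j - (m + a i) = n + (1 + a j - a i) by ring]
      ring
  have eB : itS (((List.finRange r).take i).map (F m)) (-(N : ℤ)) m =
      (((List.finRange r).take i).map x).prod ^ (m + 1) *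
      (((List.finRange r).take i).map fun j => (-1 : ℂ) ^ K j).prod *
      cmhzP (((List.finRange r).take i).reverse.map
          fun j => (K j, (x j)⁻¹, 1 + a i - a j)) (N + m).toNat := by
    rw [itS_reflect (m - 1), ← List.map_reverse, List.map_map, cmhzP_eq, List.map_map,
      ← prod_map_zpow', ← List.prod_map_mul]
    rw [itS_scale (g := phT ∘ fun j => (K j, (x j)⁻¹, 1 + a i - a j))
      (c := fun j => x j ^ (m + 1) * (-1 : ℂ) ^ K j)]
    · congr 1
      · exact ((List.reverse_perm _).map _).prod_eq
      · congr 1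
        · ring
        · rw [Int.toNat_of_nonneg (by omega)]; ring
    · intro j hj n
      have hji : j ≠ i := by
        have := mem_take_finRange _ _ (List.mem_reverse.1 hj)
        rintro rfl
        omega
      simp only [Function.comp, hF, hji, if_false, phT]
      rw [inv_zpow', show m - 1 - n + 1 = (m + 1) + -(n + 1) by ring, zpow_add₀ (hx j),
        div_eq_mul_inv]
      push_cast
      rw [show (m : ℂ) - 1 - n + a j - (m + a i) = (-1) * (n + (1 + a i - a j)) by ring, mul_pow,
        mul_inv, ← inv_pow (-1 : ℂ), show (-1 : ℂ)⁻¹ = -1 by norm_num]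
      ring
  have eX : (∏ j, x j) = (((List.finRange r).take i).map x).prod * (x i *
      (((List.finRange r).drop (i + 1)).map x).prod) := by
    rw [← List.prod_ofFn, List.ofFn_eq_map]
    conv_lhs => rw [finRange_split i]
    rw [List.map_append, List.prod_append, List.map_cons, List.prod_cons]
  rw [eA, eB]
  simp only [phT]
  rw [eX, mul_zpow, mul_zpow, show F m i m = x i ^ (m + 1) * (((m : ℂ) + a i) ^ l)⁻¹ by simp [hF],
    div_eq_mul_inv]
  ring

theorem IsRootOfUnity.norm_eq {z : ℂ} (h : IsRootOfUnity z) : ‖z‖ = 1 := by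
  obtain ⟨N, hN, hz⟩ := h
  have := congrArg norm hz
  rw [norm_pow, norm_one] at this
  exact (pow_eq_one_iff_of_nonneg (norm_nonneg z) hN.ne').1 this

theorem IsRootOfUnity.ne_zero {z : ℂ} (h : IsRootOfUnity z) : z ≠ 0 := by
  rintro rfl
  simpa using h.norm_eq

theorem IsRootOfUnity.inv {z : ℂ} (h : IsRootOfUnity z) : IsRootOfUnity z⁻¹ := by
  obtain ⟨N, hN, hz⟩ := h
  exact ⟨N, hN, by rw [inv_pow, hz, inv_one]⟩

theorem IsRootOfUnity.mul {z w : ℂ} (h : IsRootOfUnity z) (h' : IsRootOfUnity w) :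
    IsRootOfUnity (z * w) := by
  obtain ⟨N, hN, hz⟩ := h
  obtain ⟨M, hM, hw⟩ := h'
  refine ⟨N * M, by positivity, ?_⟩
  rw [mul_pow, pow_mul, hz, one_pow, one_mul, mul_comm, pow_mul, hw, one_pow]

theorem IsRootOfUnity.prod {ι : Type} (s : Finset ι) (x : ι → ℂ) (h : ∀ j ∈ s, IsRootOfUnity (x j)) :
    IsRootOfUnity (∏ j ∈ s, x j) :=
  Finset.prod_induction x IsRootOfUnity (fun _ _ => IsRootOfUnity.mul) ⟨1, one_pos, by simp⟩ h

/-- Standing hypotheses of the proof. -/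
structure SymCtx (r : ℕ) (κ : Fin r → ℕ) (x a : Fin r → ℂ) (R : Subring ℂ) (B : ℂ → Prop) :
    Prop where
  hr : 2 ≤ r
  hκ : ∀ j, 0 < κ j
  ha : ∀ j, ∀ z : ℤ, a j ≠ (z : ℂ)
  hij : ∀ i j, i < j → ∀ t : ℕ, a j - a i ≠ -((t : ℂ) + 1)
  hx : ∀ j, IsRootOfUnity (x j)
  h1 : ∀ j : Fin r, j.val = 0 → ¬ (κ j = 1 ∧ x j = 1)
  hl : ∀ j : Fin r, j.val + 1 = r → ¬ (κ j = 1 ∧ x j = 1)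
  hX : ∏ j, x j ≠ 1
  rat : ∀ q : ℚ, (q : ℂ) ∈ R
  rou : ∀ z, IsRootOfUnity z → z ∈ R
  LR : ∀ L : List (ℕ × ℂ × ℂ), L.length ≤ r - 1 →
    (∀ p ∈ L, 0 < p.1 ∧ IsRootOfUnity p.2.1 ∧ B p.2.2) → ∀ z, Tendsto (cmhzP L) atTop (nhds z) →
    z ∈ R
  Ba : ∀ i, B (a i)
  Ba' : ∀ i, B (1 - a i)
  Bd : ∀ i j, B (1 + a i - a j)

namespace SymCtx

variable {r : ℕ} {κ : Fin r → ℕ} {x a : Fin r → ℂ} {R : Subring ℂ} {B : ℂ → Prop}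

theorem hX' (h : SymCtx r κ x a R B) : IsRootOfUnity (∏ j, x j) :=
  IsRootOfUnity.prod _ _ fun j _ => h.hx j

theorem ha1 (h : SymCtx r κ x a R B) (j : Fin r) (n : ℕ) : (n : ℂ) + a j ≠ 0 := by
  intro e
  refine h.ha j (-(n : ℤ)) ?_
  push_cast
  linear_combination e

theorem ha2 (h : SymCtx r κ x a R B) (j : Fin r) (n : ℕ) : (n : ℂ) + (1 - a j) ≠ 0 := by
  intro e
  refine h.ha j ((n : ℤ) + 1) ?_
  push_cast
  linear_combination -e

theorem hd (h : SymCtx r κ x a R B) {i j : Fin r} (hij : i < j) (n : ℕ) :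
    (n : ℂ) + (1 + a j - a i) ≠ 0 := by
  intro e
  refine h.hij i j hij n ?_
  linear_combination e

/-- A general list: value exists with rate, and lies in `R` when short. -/
theorem list_val (h : SymCtx r κ x a R B) (L : List (ℕ × ℂ × ℂ))
    (hL : ∀ p ∈ L, 0 < p.1 ∧ IsRootOfUnity p.2.1 ∧ B p.2.2 ∧ ∀ n : ℕ, (n : ℂ) + p.2.2 ≠ 0)
    (hlast : ∀ p, L.getLast? = some p → ¬ (p.1 = 1 ∧ p.2.1 = 1)) :
    ∃ l C, 0 ≤ C ∧ (∀ n, ‖cmhzP L n - l‖ ≤ C / qr n ^ 3) ∧ (L.length ≤ r - 1 → l ∈ R) := by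
  obtain ⟨l, C, hC, hr⟩ := cmhzP_rate L
    (fun p hp => ⟨(hL p hp).1, (hL p hp).2.1.norm_eq, (hL p hp).2.2.2⟩) hlast
  exact ⟨l, C, hC, hr, fun hlen => h.LR L hlen
    (fun p hp => ⟨(hL p hp).1, (hL p hp).2.1, (hL p hp).2.2.1⟩) l (tendsto_of_rate _ _ _ hr)⟩

theorem after_val (h : SymCtx r κ x a R B) (i : Fin r) (K : Fin r → ℕ)
    (hK : ∀ j, j ≠ i → κ j ≤ K j) :
    ∃ l C, 0 ≤ C ∧ (∀ n, ‖cmhzP (((List.finRange r).drop (i + 1)).map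
          fun j => (K j, x j, 1 + a j - a i)) n - l‖ ≤ C / qr n ^ 3) ∧ l ∈ R := by
  obtain ⟨l, C, hC, hrate, hR⟩ := h.list_val (((List.finRange r).drop (i + 1)).map
          fun j => (K j, x j, 1 + a j - a i)) (by
      intro p hp
      obtain ⟨j, hj, rfl⟩ := List.mem_map.1 hp
      have h1 := mem_drop_finRange _ _ hj
      have hij : i < j := by rw [Fin.lt_def]; omega
      exact ⟨(h.hκ j).trans_le (hK j hij.ne'), h.hx j, h.Bd j i, h.hd hij⟩) (by
      intro p hp
      rw [List.getLast?_map, Option.map_eq_some_iff] at hp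
      obtain ⟨j, hj, rfl⟩ := hp
      have h1 := mem_drop_finRange _ _ (List.mem_of_getLast? hj)
      have h2 := last_drop_finRange _ _ hj
      have hij : i < j := by rw [Fin.lt_def]; omega
      rintro ⟨h3, h4⟩
      have h5 := hK j hij.ne'
      have h6 := h.hκ j
      simp only at h3 h4
      exact h.hl j h2 ⟨by omega, h4⟩)
  exact ⟨l, C, hC, hrate, hR (by simp; omega)⟩

theorem before_val (h : SymCtx r κ x a R B) (i : Fin r) (K : Fin r → ℕ)
    (hK : ∀ j, j ≠ i → κ j ≤ K j) :
    ∃ l C, 0 ≤ C ∧ (∀ n, ‖cmhzP (((List.finRange r).take i).reverse.map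
          fun j => (K j, (x j)⁻¹, 1 + a i - a j)) n - l‖ ≤ C / qr n ^ 3) ∧ l ∈ R := by
  obtain ⟨l, C, hC, hrate, hR⟩ := h.list_val (((List.finRange r).take i).reverse.map
          fun j => (K j, (x j)⁻¹, 1 + a i - a j)) (by
      intro p hp
      obtain ⟨j, hj, rfl⟩ := List.mem_map.1 hp
      have h1 := mem_take_finRange _ _ (List.mem_reverse.1 hj)
      have hij : j < i := by rw [Fin.lt_def]; omega
      exact ⟨(h.hκ j).trans_le (hK j hij.ne), (h.hx j).inv, h.Bd i j, h.hd hij⟩) (by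
      intro p hp
      rw [List.getLast?_map, Option.map_eq_some_iff] at hp
      obtain ⟨j, hj, rfl⟩ := hp
      have h1 := mem_take_finRange _ _ (List.mem_reverse.1 (List.mem_of_getLast? hj))
      rw [List.getLast?_reverse] at hj
      have h2 := head_take_finRange _ _ hj
      have hij : j < i := by rw [Fin.lt_def]; omega
      rintro ⟨h3, h4⟩
      have h5 := hK j hij.ne
      have h6 := h.hκ j
      simp only [inv_eq_one] at h3 h4
      exact h.h1 j h2 ⟨by omega, h4⟩)
  exact ⟨l, C, hC, hrate, hR (by simp; omega)⟩

theorem neg_one_pow_mem (R : Subring ℂ) (n : ℕ) : (-1 : ℂ) ^ n ∈ R :=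
  R.pow_mem (R.neg_mem R.one_mem) n

/-- The one-variable bilateral sum. -/
theorem mono_val (h : SymCtx r κ x a R B) (i : Fin r) (l : ℕ) (hl : 0 < l) :
    ∃ P ∈ R, Tendsto (fun N : ℕ => ∑ n ∈ Finset.Ico (-(N : ℤ)) N, phT (l, ∏ j, x j, a i) n)
      atTop (nhds P) := by
  have hX := h.hX'
  have hr := h.hr
  obtain ⟨l1, C1, hC1, hr1, hR1⟩ := h.list_val [(l, ∏ j, x j, a i)]
    (by intro p hp; rw [List.mem_singleton] at hp; subst hp
        exact ⟨hl, hX, h.Ba i, h.ha1 i⟩)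
    (by intro p hp
        simp only [List.getLast?_singleton, Option.some.injEq] at hp; subst hp
        exact fun e => h.hX e.2)
  obtain ⟨l2, C2, hC2, hr2, hR2⟩ := h.list_val [(l, (∏ j, x j)⁻¹, 1 - a i)]
    (by intro p hp; rw [List.mem_singleton] at hp; subst hp
        exact ⟨hl, hX.inv, h.Ba' i, h.ha2 i⟩)
    (by intro p hp
        simp only [List.getLast?_singleton, Option.some.injEq] at hp; subst hp
        exact fun e => h.hX (inv_eq_one.1 e.2))
  have t1 := tendsto_of_rate _ _ _ hr1
  have t2 := tendsto_of_rate _ _ _ hr2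
  refine ⟨l1 + (∏ j, x j) * (-1) ^ l * l2, R.add_mem (hR1 (by simp; omega))
    (R.mul_mem (R.mul_mem (h.rou _ hX) (neg_one_pow_mem R l)) (hR2 (by simp; omega))), ?_⟩
  refine (t1.add (t2.const_mul ((∏ j, x j) * (-1) ^ l))).congr fun N => ?_
  have e := itS_tangent [(l, ∏ j, x j, a i)] (by
    intro p hp; rw [List.mem_singleton] at hp; subst hp; exact hX.ne_zero) N
  have e2 : itS (List.map phT [(l, ∏ j, x j, a i)]) (-(N : ℤ)) N =
      ∑ n ∈ Finset.Ico (-(N : ℤ)) N, phT (l, ∏ j, x j, a i) n := by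
    simp [itS]
  rw [e2] at e
  rw [e, List.length_singleton, Finset.sum_range_succ, Finset.sum_range_one]
  simp [cmhzP_nil, reflT]

theorem phT_bound_int (h : SymCtx r κ x a R B) (i : Fin r) (l : ℕ) (hl : 0 < l) :
    ∃ C : ℝ, 0 ≤ C ∧ ∀ n : ℤ, ‖phT (l, ∏ j, x j, a i) n‖ ≤ C * (1 / qr n.natAbs ^ 4) := by
  have hX := h.hX'
  obtain ⟨C1, hC1, h1⟩ := phT_bound (l, ∏ j, x j, a i) hX.norm_eq 1 hl
  obtain ⟨C2, hC2, h2⟩ := phT_bound (reflT (l, ∏ j, x j, a i)) hX.inv.norm_eq 1 hl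
  refine ⟨C1 + 2 * C2, by positivity, fun n => ?_⟩
  rcases le_or_gt 0 n with hn | hn
  · obtain ⟨m, rfl⟩ := Int.eq_ofNat_of_zero_le hn
    have hq := qr_pos m
    refine (h1 m).trans ?_
    rw [pow_one, Int.natAbs_natCast, div_eq_mul_one_div]
    gcongr
    linarith
  · obtain ⟨m, rfl⟩ : ∃ m : ℕ, n = -1 - (m : ℤ) := ⟨(-1 - n).toNat, by omega⟩
    rw [phT_reflect _ hX.ne_zero, norm_mul, norm_mul, norm_pow, norm_neg, norm_one, one_pow,
      mul_one, hX.norm_eq, one_mul]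
    have e : (-1 - (m : ℤ)).natAbs = m + 1 := by omega
    have hq := qr_pos m
    have hq1 := qr_pos (m + 1)
    refine (h2 m).trans ?_
    rw [e, pow_one]
    have h3 : C2 / qr m ^ 4 ≤ 2 * C2 * (1 / qr (m + 1) ^ 4) := by
      rw [qr_pow, qr_pow, mul_one_div, div_le_div_iff₀ (by positivity) (by positivity)]
      have : (0 : ℝ) ≤ m := by positivity
      push_cast
      nlinarith
    refine h3.trans ?_
    gcongr
    linarith

theorem term_val (h : SymCtx r κ x a R B) (i : Fin r) (l : ℕ) (hl : 0 < l) (K : Fin r → ℕ)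
    (hK : ∀ j, j ≠ i → κ j ≤ K j) :
    ∃ P ∈ R, Tendsto (fun N : ℕ => ∑ n ∈ smT r (-(N : ℤ)) N,
      (∏ j, x j ^ (n j + 1)) * pfT i l K (fun j => (n j : ℂ) + a j)) atTop (nhds P) := by
  obtain ⟨lA, CA, hCA, hA, hAR⟩ := h.after_val i K hK
  obtain ⟨lB, CB, hCB, hB, hBR⟩ := h.before_val i K hK
  obtain ⟨P, hPR, hP⟩ := h.mono_val i l hl
  obtain ⟨C, hC, hw⟩ := h.phT_bound_int i l hl
  have := conv_limit _ C hC hw _ _ lA lB CA CB hCA hCB hA hB P hP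
  refine ⟨(((List.finRange r).take i).map fun j => (-1 : ℂ) ^ K j).prod * (P * (lB * lA)), ?_, ?_⟩
  · refine R.mul_mem (R.list_prod_mem ?_) (R.mul_mem hPR (R.mul_mem hBR hAR))
    intro z hz
    obtain ⟨j, _, rfl⟩ := List.mem_map.1 hz
    exact neg_one_pow_mem R _
  · refine (this.const_mul _).congr fun N => ?_
    rw [term_sum x a (fun j => (h.hx j).ne_zero) i l K N]

theorem span_val (h : SymCtx r κ x a R B) (f : (Fin r → ℂ) → ℂ) (hf : f ∈ pfV κ) :
    ∃ P ∈ R, Tendsto (fun N : ℕ => ∑ n ∈ smT r (-(N : ℤ)) N,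
      (∏ j, x j ^ (n j + 1)) * f (fun j => (n j : ℂ) + a j)) atTop (nhds P) := by
  induction hf using Submodule.span_induction with
  | mem f hf =>
    obtain ⟨i, l, K, hl, hK, rfl⟩ := hf
    exact h.term_val i l hl K hK
  | zero => exact ⟨0, R.zero_mem, by simp⟩
  | add f g _ _ hf hg =>
    obtain ⟨P, hP, hf⟩ := hf
    obtain ⟨Q, hQ, hg⟩ := hg
    refine ⟨P + Q, R.add_mem hP hQ, (hf.add hg).congr fun N => ?_⟩
    rw [← Finset.sum_add_distrib]
    refine Finset.sum_congr rfl fun n _ => ?_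
    rw [Pi.add_apply]; ring
  | smul c f _ hf =>
    obtain ⟨P, hP, hf⟩ := hf
    refine ⟨c * P, R.mul_mem (h.rat c) hP, (hf.const_mul (c : ℂ)).congr fun N => ?_⟩
    rw [Finset.mul_sum]
    refine Finset.sum_congr rfl fun n _ => ?_
    rw [Pi.smul_apply, Rat.smul_def]; ring

/-- The basic list of triples. -/
noncomputable def lst (κ : Fin r → ℕ) (x a : Fin r → ℂ) : List (ℕ × ℂ × ℂ) :=
  (List.finRange r).map fun j => (κ j, x j, a j)

theorem total_val (h : SymCtx r κ x a R B) :
    ∃ P ∈ R, Tendsto (fun N : ℕ => itS ((lst κ x a).map phT) (-(N : ℤ)) N) atTop (nhds P) := by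
  obtain ⟨f, hf, hfy⟩ := pf_main (show 0 < r by have := h.hr; omega) _ κ h.hκ rfl
  obtain ⟨P, hP, hT⟩ := h.span_val f hf
  refine ⟨P, hP, hT.congr fun N => ?_⟩
  rw [lst, List.map_map, ← List.ofFn_eq_map, ← sum_smT]
  refine Finset.sum_congr rfl fun n hn => ?_
  rw [mem_smT] at hn
  have key : ∀ i j, i < j → (n i : ℂ) + a i ≠ n j + a j := by
    intro i j hij e
    have h1 := hn.2 hij
    refine h.hd hij (n j - n i - 1).toNat ?_
    have h2 : (((n j - n i - 1).toNat : ℤ) : ℂ) = n j - n i - 1 := by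
      rw [Int.toNat_of_nonneg (by omega)]; push_cast; ring
    rw [Int.cast_natCast] at h2
    rw [h2]
    linear_combination -e
  rw [← hfy, ← Finset.prod_mul_distrib]
  · refine Finset.prod_congr rfl fun j _ => ?_
    simp only [Function.comp, phT]
    rw [div_eq_mul_inv]
  · refine ⟨fun j e => h.ha j (-(n j)) ?_, fun i j hij => ?_⟩
    · push_cast
      linear_combination e
    · rcases lt_trichotomy i j with h1 | h1 | h1
      · exact absurd hij (key i j h1)
      · exact h1
      · exact absurd hij.symm (key j i h1)

theorem drop_val (h : SymCtx r κ x a R B) (t : ℕ) :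
    ∃ l, Tendsto (cmhzP ((lst κ x a).drop t)) atTop (nhds l) ∧ (0 < t → l ∈ R) := by
  obtain ⟨l, C, hC, hrate, hR⟩ := h.list_val ((lst κ x a).drop t) (by
      intro p hp
      obtain ⟨j, hj, rfl⟩ := List.mem_map.1 (List.mem_of_mem_drop hp)
      exact ⟨h.hκ j, h.hx j, h.Ba j, h.ha1 j⟩) (by
      intro p hp
      rw [lst, ← List.map_drop, List.getLast?_map, Option.map_eq_some_iff] at hp
      obtain ⟨j, hj, rfl⟩ := hp
      exact h.hl j (last_drop_finRange _ _ hj))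
  exact ⟨l, tendsto_of_rate _ _ _ hrate, fun ht => hR (by simp [lst]; omega)⟩

theorem take_val (h : SymCtx r κ x a R B) (t : ℕ) :
    ∃ l, Tendsto (cmhzP (((lst κ x a).take t).reverse.map reflT)) atTop (nhds l) ∧
      (t < r → l ∈ R) := by
  obtain ⟨l, C, hC, hrate, hR⟩ := h.list_val (((lst κ x a).take t).reverse.map reflT) (by
      intro p hp
      obtain ⟨q, hq, rfl⟩ := List.mem_map.1 hp
      obtain ⟨j, hj, rfl⟩ := List.mem_map.1 (List.mem_of_mem_take (List.mem_reverse.1 hq))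
      exact ⟨h.hκ j, (h.hx j).inv, h.Ba' j, h.ha2 j⟩) (by
      intro p hp
      rw [lst, ← List.map_take, List.getLast?_map, List.getLast?_reverse, List.head?_map,
        Option.map_map, Option.map_eq_some_iff] at hp
      obtain ⟨j, hj, rfl⟩ := hp
      simp only [Function.comp, reflT, inv_eq_one]
      exact h.h1 j (head_take_finRange _ _ hj))
  exact ⟨l, tendsto_of_rate _ _ _ hrate, fun ht => hR (by simp [lst]; omega)⟩

theorem main (h : SymCtx r κ x a R B) :
    cmhz (lst κ x a) + ((lst κ x a).map fun p => p.2.1 * (-1) ^ p.1).prod *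
      cmhz ((lst κ x a).reverse.map reflT) ∈ R := by
  obtain ⟨P, hP, hT⟩ := h.total_val
  choose d hd hdR using h.drop_val
  choose e he heR using h.take_val
  have hlen : (lst κ x a).length = r := by simp [lst]
  set c : ℕ → ℂ := fun t => (((lst κ x a).take t).map fun p => p.2.1 * (-1) ^ p.1).prod with hc
  have hcR : ∀ t, c t ∈ R := by
    intro t
    refine R.list_prod_mem fun z hz => ?_
    obtain ⟨p, hp, rfl⟩ := List.mem_map.1 hz
    obtain ⟨j, _, rfl⟩ := List.mem_map.1 (List.mem_of_mem_take hp)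
    exact R.mul_mem (h.rou _ (h.hx j)) (neg_one_pow_mem R _)
  have hT2 : Tendsto (fun N : ℕ => itS ((lst κ x a).map phT) (-(N : ℤ)) N) atTop
      (nhds (∑ t ∈ Finset.range (r + 1), c t * e t * d t)) := by
    have := tendsto_finsetSum (Finset.range (r + 1)) fun t (_ : t ∈ Finset.range (r + 1)) =>
      (((he t).const_mul (c t)).mul (hd t))
    refine this.congr fun N => ?_
    rw [itS_tangent, hlen]
    intro p hp
    obtain ⟨j, _, rfl⟩ := List.mem_map.1 hp
    exact (h.hx j).ne_zero
  have hPe := tendsto_nhds_unique hT hT2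
  obtain ⟨s, rfl⟩ : ∃ s, r = s + 1 := ⟨r - 1, by have := h.hr; omega⟩
  rw [Finset.sum_range_succ, Finset.sum_range_succ'] at hPe
  have e0 : e 0 = 1 := by
    refine tendsto_nhds_unique (he 0) ?_
    simp only [List.take_zero, List.reverse_nil, List.map_nil]
    exact tendsto_const_nhds.congr fun N => (cmhzP_nil N).symm
  have d1 : d (s + 1) = 1 := by
    refine tendsto_nhds_unique (hd (s + 1)) ?_
    rw [List.drop_of_length_le hlen.le]
    exact tendsto_const_nhds.congr fun N => (cmhzP_nil N).symm
  have d0 : cmhz (lst κ x a) = d 0 := by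
    have := hd 0
    rw [List.drop_zero] at this
    exact this.limUnder_eq
  have e1 : cmhz ((lst κ x a).reverse.map reflT) = e (s + 1) := by
    have := he (s + 1)
    rw [List.take_of_length_le hlen.le] at this
    exact this.limUnder_eq
  have c0 : c 0 = 1 := by simp [hc]
  have c1 : c (s + 1) = ((lst κ x a).map fun p => p.2.1 * (-1) ^ p.1).prod := by
    simp only [hc]
    rw [List.take_of_length_le hlen.le]
  rw [d0, e1, ← c1]
  have : d 0 + c (s + 1) * e (s + 1) =
      P - ∑ t ∈ Finset.range s, c (t + 1) * e (t + 1) * d (t + 1) := by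
    rw [hPe, e0, d1, c0]; ring
  rw [this]
  refine R.sub_mem hP (R.sum_mem fun t ht => ?_)
  rw [Finset.mem_range] at ht
  exact R.mul_mem (R.mul_mem (hcR _) (heR _ (by omega))) (hdR _ (by omega))

end SymCtx

/-- Symmetry of cyclotomic multiple Hurwitz zeta values modulo products of lower depth
(Corollary `main-thm-corthree`). -/
theorem symmetry_cmhz_mod_products (r : ℕ) (hr : 2 ≤ r) (k : ℕ → ℕ) (x : ℕ → ℂ) (a : ℕ → ℂ)
    (hk : ∀ i, 1 ≤ i → i ≤ r → 0 < k i)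
    (ha : ∀ i, 1 ≤ i → i ≤ r → ∀ z : ℤ, a i ≠ (z : ℂ))
    (hij : ∀ i j, 1 ≤ i → i < j → j ≤ r → ∀ t : ℕ, a j - a i ≠ -((t : ℂ) + 1))
    (hx : ∀ i, 1 ≤ i → i ≤ r → IsRootOfUnity (x i))
    (h1 : ¬(k 1 = 1 ∧ x 1 = 1)) (hrr : ¬(k r = 1 ∧ x r = 1))
    (hX : (∏ i ∈ Finset.Icc 1 r, x i) ≠ 1) :
    cmhz (List.ofFn fun i : Fin r => (k (i.val + 1), x (i.val + 1), a (i.val + 1)))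
      - (-1 : ℂ) ^ ((∑ i ∈ Finset.Icc 1 r, k i) - 1)
        * (∏ i ∈ Finset.Icc 1 r, x i)
        * cmhz (List.ofFn fun i : Fin r => (k (r - i.val), (x (r - i.val))⁻¹, 1 - a (r - i.val)))
    ∈ Subring.closure
        ((Subfield.closure {z : ℂ | IsRootOfUnity z} : Set ℂ)
          ∪ {z : ℂ | ∃ L : List (ℕ × ℂ × ℂ), L.length ≤ r - 1 ∧
              (∀ p ∈ L, 0 < p.1 ∧ IsRootOfUnity p.2.1 ∧
                p.2.2 ∈ {w : ℂ | ∃ i j : ℕ, 1 ≤ i ∧ i ≤ r ∧ 1 ≤ j ∧ j ≤ r ∧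
                  (w = a i ∨ w = 1 - a i ∨ w = 1 + a i - a j ∨ w = 1 - a i + a j)}) ∧
              Tendsto (cmhzP L) atTop (nhds z)}) := by
  set R := Subring.closure
        ((Subfield.closure {z : ℂ | IsRootOfUnity z} : Set ℂ)
          ∪ {z : ℂ | ∃ L : List (ℕ × ℂ × ℂ), L.length ≤ r - 1 ∧
              (∀ p ∈ L, 0 < p.1 ∧ IsRootOfUnity p.2.1 ∧
                p.2.2 ∈ {w : ℂ | ∃ i j : ℕ, 1 ≤ i ∧ i ≤ r ∧ 1 ≤ j ∧ j ≤ r ∧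
                  (w = a i ∨ w = 1 - a i ∨ w = 1 + a i - a j ∨ w = 1 - a i + a j)}) ∧
              Tendsto (cmhzP L) atTop (nhds z)}) with hR
  have hprod : ∏ j : Fin r, x (j.val + 1) = ∏ i ∈ Finset.Icc 1 r, x i := by
    rw [Fin.prod_univ_eq_prod_range (fun i => x (i + 1)), Finset.range_eq_Ico,
      Finset.prod_Ico_add' x 0 r 1]
    rfl
  have hsum : ∑ j : Fin r, k (j.val + 1) = ∑ i ∈ Finset.Icc 1 r, k i := by
    rw [Fin.sum_univ_eq_sum_range (fun i => k (i + 1)), Finset.range_eq_Ico,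
      Finset.sum_Ico_add' k 0 r 1]
    rfl
  have ctx : SymCtx r (fun j => k (j.val + 1)) (fun j => x (j.val + 1)) (fun j => a (j.val + 1)) R
      (fun w => ∃ i j : ℕ, 1 ≤ i ∧ i ≤ r ∧ 1 ≤ j ∧ j ≤ r ∧
                  (w = a i ∨ w = 1 - a i ∨ w = 1 + a i - a j ∨ w = 1 - a i + a j)) :=
    { hr := hr
      hκ := fun j => hk _ (by omega) (by omega)
      ha := fun j => ha _ (by omega) (by omega)
      hij := fun i j h => hij _ _ (by omega) (by rw [Fin.lt_def] at h; omega) (by omega)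
      hx := fun j => hx _ (by omega) (by omega)
      h1 := fun j hj => by simp only [hj, zero_add]; exact h1
      hl := fun j hj => by simp only [hj]; exact hrr
      hX := by rw [hprod]; exact hX
      rat := fun q => Subring.subset_closure (Or.inl (SubfieldClass.ratCast_mem _ q))
      rou := fun z hz => Subring.subset_closure (Or.inl (Subfield.subset_closure hz))
      LR := fun L hL hp z hz => Subring.subset_closure (Or.inr ⟨L, hL, hp, hz⟩)
      Ba := fun i => ⟨i + 1, i + 1, by omega, by omega, by omega, by omega, Or.inl rfl⟩
      Ba' := fun i => ⟨i + 1, i + 1, by omega, by omega, by omega, by omega, Or.inr (Or.inl rfl)⟩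
      Bd := fun i j => ⟨i + 1, j + 1, by omega, by omega, by omega, by omega,
        Or.inr (Or.inr (Or.inl rfl))⟩ }
  have hm := ctx.main
  have e1 : (List.ofFn fun i : Fin r => (k (i.val + 1), x (i.val + 1), a (i.val + 1))) =
      SymCtx.lst (fun j : Fin r => k (j.val + 1)) (fun j => x (j.val + 1))
        (fun j => a (j.val + 1)) := by
    rw [SymCtx.lst, List.ofFn_eq_map]
  have e2 : (List.ofFn fun i : Fin r => (k (r - i.val), (x (r - i.val))⁻¹, 1 - a (r - i.val))) =
      (SymCtx.lst (fun j : Fin r => k (j.val + 1)) (fun j => x (j.val + 1))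
        (fun j => a (j.val + 1))).reverse.map reflT := by
    refine List.ext_getElem (by simp [SymCtx.lst]) fun t h1 h2 => ?_
    simp only [List.length_ofFn] at h1
    simp only [SymCtx.lst, List.getElem_ofFn, List.getElem_map, List.getElem_reverse, reflT,
      List.length_map, List.length_finRange, List.getElem_finRange, Fin.cast_mk]
    rw [show r - 1 - t + 1 = r - t by omega]
  have e3 : ((SymCtx.lst (fun j : Fin r => k (j.val + 1)) (fun j => x (j.val + 1))
        (fun j => a (j.val + 1))).map fun p => p.2.1 * (-1) ^ p.1).prod =
      (∏ i ∈ Finset.Icc 1 r, x i) * (-1) ^ (∑ i ∈ Finset.Icc 1 r, k i) := by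
    rw [SymCtx.lst, List.map_map, ← List.ofFn_eq_map, List.prod_ofFn, ← hprod, ← hsum,
      ← Finset.prod_pow_eq_pow_sum, ← Finset.prod_mul_distrib]
    rfl
  have hpos : 1 ≤ ∑ i ∈ Finset.Icc 1 r, k i := by
    have h2 := Finset.single_le_sum (f := k) (fun i _ => Nat.zero_le _)
      (Finset.mem_Icc.2 ⟨le_rfl, (by omega : 1 ≤ r)⟩)
    have := hk 1 le_rfl (by omega)
    omega
  rw [e1, e2]
  rw [e3] at hm
  obtain ⟨s, hs⟩ : ∃ s, ∑ i ∈ Finset.Icc 1 r, k i = s + 1 := ⟨_, (Nat.sub_add_cancel hpos).symm⟩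
  rw [hs] at hm ⊢
  rw [Nat.add_sub_cancel]
  convert hm using 1
  rw [pow_succ]
  ring
end

section
/- Let θ ∈ (0, 2π), x := e^{iθ}, a ∈ ℂ∖ℤ, and let m ≥ 0 be an integer. Then lim_{N→∞} Σ_{n=1}^{N} x^n/(n−a)^{m+1} − (−1)^m x · lim_{N→∞} Σ_{n=1}^{N} x^{−n}/(n+a−1)^{m+1} = (π/m!) · f^{(m)}(a), where f is the function f(w) := i e^{iwθ} − cot(πw) e^{iwθ} (with cot(πw) = cos(πw)/sin(πw) and i the imaginary unit) and f^{(m)} denotes its m-th derivative; in particular both limits of partial sums exist. -/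
open Filter Finset

lemma aux_lower (R : ℝ) (w : ℂ) (hw : ‖w‖ ≤ R) (n : ℕ) (hn : 2 * R ≤ n) :
    (n : ℝ) / 2 ≤ ‖(n : ℂ) + w‖ := by
  have h := norm_sub_norm_le (n : ℂ) (-w)
  rw [sub_neg_eq_add, norm_neg, Complex.norm_natCast] at h
  linarith

lemma aux_inv (R : ℝ) (w : ℂ) (hw : ‖w‖ ≤ R) (n : ℕ) (hn : 2 * R ≤ n) (hn0 : 1 ≤ n) :
    ‖((n : ℂ) + w)⁻¹‖ ≤ 2 / n := by
  have h := aux_lower R w hw n hn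
  have h0 : (0 : ℝ) < n := by exact_mod_cast hn0
  rw [norm_inv]
  calc ‖(n : ℂ) + w‖⁻¹ ≤ ((n : ℝ) / 2)⁻¹ := inv_anti₀ (by positivity) h
    _ = 2 / n := by rw [inv_div]

lemma aux_diff (R : ℝ) (w : ℂ) (hw : ‖w‖ ≤ R) (n : ℕ) (hn : 2 * R ≤ n) (hn0 : 1 ≤ n) :
    ‖((n : ℂ) + 1 + w)⁻¹ - ((n : ℂ) + w)⁻¹‖ ≤ 4 * (1 / (n : ℝ) ^ 2) := by
  have h0 : (0 : ℝ) < n := by exact_mod_cast hn0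
  have h1 := aux_lower R w hw n hn
  have h2 := aux_lower R w hw (n + 1) (by push_cast; linarith)
  have e1 := aux_inv R w hw n hn hn0
  have e2 := aux_inv R w hw (n + 1) (by push_cast; linarith) (by omega)
  push_cast at h2 e2
  have z1 : (n : ℂ) + w ≠ 0 := by
    intro h; rw [h, norm_zero] at h1; linarith
  have z2 : (n : ℂ) + 1 + w ≠ 0 := by
    intro h; rw [h, norm_zero] at h2; linarith
  have : ((n : ℂ) + 1 + w)⁻¹ - ((n : ℂ) + w)⁻¹ = -(((n : ℂ) + 1 + w)⁻¹ * ((n : ℂ) + w)⁻¹) := by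
    field_simp; ring
  rw [this, norm_neg, norm_mul]
  have e3 : 2 / ((n : ℝ) + 1) ≤ 2 / n := by gcongr; linarith
  calc _ ≤ (2 / (n : ℝ)) * (2 / n) := by gcongr; exact e2.trans e3
    _ = _ := by field_simp; norm_num

lemma aux_summable (w : ℂ) :
    Summable fun n : ℕ => ((n : ℂ) + 1 + w)⁻¹ - ((n : ℂ) + w)⁻¹ := by
  have hs : Summable fun n : ℕ => 4 * (1 / (n : ℝ) ^ 2) :=
    (Real.summable_one_div_nat_pow.mpr (by norm_num)).mul_left 4
  refine Summable.of_norm_bounded_eventually_nat hs ?_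
  filter_upwards [eventually_ge_atTop (⌈2 * ‖w‖⌉₊), eventually_ge_atTop 1] with n h1 h2
  exact aux_diff ‖w‖ w le_rfl n (Nat.ceil_le.mp h1) h2

lemma aux_abel (y : ℂ) (f : ℕ → ℂ) (N : ℕ) :
    (1 - y) * ∑ n ∈ range N, y ^ n * f n
      = f 0 + ∑ n ∈ range N, y ^ (n + 1) * (f (n + 1) - f n) - y ^ N * f N := by
  induction N with
  | zero => simp
  | succ N ih => rw [sum_range_succ, mul_add, ih, sum_range_succ]; ring

lemma aux_inv_tendsto (y w : ℂ) (hy : ‖y‖ = 1) :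
    Tendsto (fun N : ℕ => y ^ N * ((N : ℂ) + w)⁻¹) atTop (nhds 0) := by
  have h2 : Tendsto (fun N : ℕ => 2 / (N : ℝ)) atTop (nhds 0) :=
    tendsto_const_div_atTop_nhds_zero_nat 2
  refine squeeze_zero_norm' ?_ h2
  filter_upwards [eventually_ge_atTop (⌈2 * ‖w‖⌉₊), eventually_ge_atTop 1] with n h1 h2
  rw [norm_mul, norm_pow, hy, one_pow, one_mul]
  exact aux_inv ‖w‖ w le_rfl n (Nat.ceil_le.mp h1) h2

/-- The complement of the integers. -/
def auxU : Set ℂ := (Set.range ((↑) : ℤ → ℂ))ᶜ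

lemma auxU_open : IsOpen auxU := Complex.isOpen_compl_range_intCast

lemma auxU_ne {w : ℂ} (hw : w ∈ auxU) (n : ℕ) : (n : ℂ) + w ≠ 0 := by
  intro h
  exact hw ⟨-(n : ℤ), by push_cast; linear_combination -h⟩

lemma aux_unif (y : ℂ) (hy : ‖y‖ = 1) (hy1 : y ≠ 1) :
    ∃ G : ℂ → ℂ, TendstoLocallyUniformlyOn
      (fun (N : ℕ) (w : ℂ) => ∑ n ∈ range N, y ^ n * ((n : ℂ) + w)⁻¹) G atTop auxU := by
  have hs : Summable fun n : ℕ => 4 * (1 / (n : ℝ) ^ 2) :=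
    (Real.summable_one_div_nat_pow.mpr (by norm_num)).mul_left 4
  have hy2 : 1 - y ≠ 0 := sub_ne_zero.mpr hy1.symm
  let t : ℕ → ℂ → ℂ := fun n w => y ^ (n + 1) * (((n + 1 : ℕ) + w : ℂ)⁻¹ - ((n : ℂ) + w)⁻¹)
  refine ⟨fun w => (1 - y)⁻¹ * ((((0 : ℕ) : ℂ) + w)⁻¹ + ∑' n, t n w), ?_⟩
  rw [tendstoLocallyUniformlyOn_iff_forall_isCompact auxU_open]
  intro K hK hKc
  obtain ⟨R, hR⟩ := hKc.isBounded.exists_norm_le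
  have hA : TendstoUniformlyOn (fun N w => ∑ n ∈ range N, t n w) (fun w => ∑' n, t n w)
      atTop K := by
    refine tendstoUniformlyOn_tsum_nat_eventually hs ?_
    filter_upwards [eventually_ge_atTop (⌈2 * R⌉₊), eventually_ge_atTop 1] with n h1 h2 w hw
    simp only [t]
    rw [norm_mul, norm_pow, hy, one_pow, one_mul]
    push_cast
    exact aux_diff R w (hR w hw) n (Nat.ceil_le.mp h1) h2
  rw [Metric.tendstoUniformlyOn_iff] at hA ⊢
  intro ε hε
  have hc : 0 < ‖1 - y‖ := norm_pos_iff.mpr hy2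
  have h2 : Tendsto (fun N : ℕ => 2 / (N : ℝ)) atTop (nhds 0) :=
    tendsto_const_div_atTop_nhds_zero_nat 2
  filter_upwards [hA (‖1 - y‖ * ε / 2) (by positivity),
    h2.eventually_lt_const (show 0 < ‖1 - y‖ * ε / 2 by positivity),
    eventually_ge_atTop (⌈2 * R⌉₊), eventually_ge_atTop 1] with N hN hN2 h3 h4 w hw
  have hab := aux_abel y (fun n => ((n : ℂ) + w)⁻¹) N
  have hP : ∑ n ∈ range N, y ^ n * ((n : ℂ) + w)⁻¹
      = (1 - y)⁻¹ * ((((0 : ℕ) : ℂ) + w)⁻¹ + ∑ n ∈ range N, t n w - y ^ N * ((N : ℂ) + w)⁻¹) := by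
    rw [← hab, inv_mul_cancel_left₀ hy2]
  have hN' := hN w hw
  have hb := aux_inv R w (hR w hw) N (Nat.ceil_le.mp h3) h4
  rw [dist_eq_norm] at hN' ⊢
  rw [hP, ← mul_sub, norm_mul, norm_inv, inv_mul_lt_iff₀ hc]
  have hb2 : ‖y ^ N * ((N : ℂ) + w)⁻¹‖ < ‖1 - y‖ * ε / 2 := by
    rw [norm_mul, norm_pow, hy, one_pow, one_mul]; linarith
  calc _ = ‖(∑' n, t n w - ∑ n ∈ range N, t n w) + y ^ N * ((N : ℂ) + w)⁻¹‖ := by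
        congr 1; ring
    _ ≤ _ := norm_add_le _ _
    _ < ‖1 - y‖ * ε / 2 + ‖1 - y‖ * ε / 2 := add_lt_add hN' hb2
    _ = _ := by ring

lemma aux_P_deriv (y : ℂ) (m N : ℕ) {w : ℂ} (hw : w ∈ auxU) :
    HasDerivAt (fun w : ℂ => ∑ n ∈ range N, y ^ n * (((n : ℂ) + w) ^ (m + 1))⁻¹)
      (-((m : ℂ) + 1) * ∑ n ∈ range N, y ^ n * (((n : ℂ) + w) ^ (m + 2))⁻¹) w := by
  rw [mul_sum]
  apply HasDerivAt.fun_sum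
  intro n _
  have h0 := auxU_ne hw n
  have h1 : HasDerivAt (fun w : ℂ => (n : ℂ) + w) 1 w := (hasDerivAt_id w).const_add _
  have h2 := ((h1.fun_pow (m + 1)).fun_inv (pow_ne_zero _ h0)).const_mul (y ^ n)
  refine h2.congr_deriv ?_
  push_cast
  field_simp
  simp
  ring

lemma aux_all (y : ℂ) (hy : ‖y‖ = 1) (hy1 : y ≠ 1) :
    ∃ G : ℂ → ℂ, DifferentiableOn ℂ G auxU ∧ ∀ m : ℕ, TendstoLocallyUniformlyOn
      (fun (N : ℕ) (w : ℂ) => ∑ n ∈ range N, y ^ n * (((n : ℂ) + w) ^ (m + 1))⁻¹)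
      (fun w => (-1) ^ m / (m.factorial : ℂ) * iteratedDeriv m G w) atTop auxU := by
  obtain ⟨G, hG⟩ := aux_unif y hy hy1
  have hd : ∀ m N : ℕ, DifferentiableOn ℂ
      (fun (w : ℂ) => ∑ n ∈ range N, y ^ n * (((n : ℂ) + w) ^ (m + 1))⁻¹) auxU :=
    fun m N w hw => (aux_P_deriv y m N hw).differentiableAt.differentiableWithinAt
  have h0 : TendstoLocallyUniformlyOn
      (fun (N : ℕ) (w : ℂ) => ∑ n ∈ range N, y ^ n * (((n : ℂ) + w) ^ (0 + 1))⁻¹) G atTop auxU := by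
    simpa using hG
  refine ⟨G, h0.differentiableOn (Eventually.of_forall fun N => hd 0 N) auxU_open, ?_⟩
  intro m
  induction m with
  | zero => simpa using hG
  | succ m ih =>
    have h1 := ih.deriv (Eventually.of_forall fun N => hd m N) auxU_open
    have h2 : TendstoLocallyUniformlyOn
      (fun (N : ℕ) (w : ℂ) => -((m : ℂ) + 1) *
        ∑ n ∈ range N, y ^ n * (((n : ℂ) + w) ^ (m + 2))⁻¹)
      (fun w => (-1) ^ m / (m.factorial : ℂ) * iteratedDeriv (m + 1) G w) atTop auxU := by
      refine (h1.congr fun N w hw => (aux_P_deriv y m N hw).deriv).congr_right ?_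
      intro w hw
      simp only [iteratedDeriv_succ, deriv_const_mul_field]
    have h3 := (uniformContinuous_const_smul (-((m : ℂ) + 1)⁻¹)
      (X := ℂ)).comp_tendstoLocallyUniformlyOn h2
    have hm : (m : ℂ) + 1 ≠ 0 := by exact_mod_cast Nat.succ_ne_zero m
    refine (h3.congr fun N w hw => ?_).congr_right fun w hw => ?_
    · simp only [Function.comp_apply, smul_eq_mul]
      field_simp
    · simp only [Function.comp_apply, smul_eq_mul, Nat.factorial_succ]
      push_cast
      field_simp
      ring

lemma aux_E_ne {a : ℂ} (ha : a ∈ auxU) : Complex.exp (2 * Real.pi * Complex.I * a) - 1 ≠ 0 := by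
  intro h
  obtain ⟨n, hn⟩ := Complex.exp_eq_one_iff.mp (sub_eq_zero.mp h)
  apply ha
  refine ⟨n, ?_⟩
  have : (2 * Real.pi * Complex.I : ℂ) ≠ 0 := Complex.two_pi_I_ne_zero
  apply mul_left_cancel₀ this
  rw [hn]; ring

lemma auxU_sub {a : ℂ} (ha : a ∈ auxU) (k : ℤ) : a - k ≠ 0 := by
  intro h
  exact ha ⟨k, by linear_combination -h⟩

lemma aux_integral {a : ℂ} (ha : a ∈ auxU) (k : ℤ) :
    ∫ t in (0 : ℝ)..1, Complex.exp (2 * Real.pi * Complex.I * (a - k) * t)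
      = (Complex.exp (2 * Real.pi * Complex.I * a) - 1) / (2 * Real.pi * Complex.I * (a - k)) := by
  have h0 : (2 * Real.pi * Complex.I * (a - k) : ℂ) ≠ 0 :=
    mul_ne_zero Complex.two_pi_I_ne_zero (auxU_sub ha k)
  rw [integral_exp_mul_complex h0]
  have : Complex.exp (2 * Real.pi * Complex.I * (a - k))
      = Complex.exp (2 * Real.pi * Complex.I * a) := by
    rw [Complex.exp_eq_exp_iff_exists_int]
    exact ⟨-k, by push_cast; ring⟩
  simp [this]

/-- the function whose Fourier series we use -/
noncomputable def auxh (a : ℂ) (t : ℝ) : ℂ :=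
  (1 - Complex.exp (2 * Real.pi * Complex.I * t)) * Complex.exp (2 * Real.pi * Complex.I * a * t)

lemma auxh_cont (a : ℂ) : Continuous (auxh a) := by
  unfold auxh; fun_prop

lemma aux_coeff {a : ℂ} (ha : a ∈ auxU) (k : ℤ) :
    fourierCoeffOn (zero_lt_one (α := ℝ)) (auxh a) k
      = -(Complex.exp (2 * Real.pi * Complex.I * a) - 1) / (2 * Real.pi * Complex.I)
        * (((k : ℂ) - a)⁻¹ - ((k : ℂ) - 1 - a)⁻¹) := by
  rw [fourierCoeffOn_eq_integral]
  have h1 : ∀ t : ℝ, fourier (-k) (t : AddCircle ((1 : ℝ) - 0)) • auxh a t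
      = Complex.exp (2 * Real.pi * Complex.I * (a - k) * t)
        - Complex.exp (2 * Real.pi * Complex.I * (a - (k - 1 : ℤ)) * t) := by
    intro t
    rw [fourier_coe_apply, smul_eq_mul, auxh, sub_mul, mul_sub, one_mul, ← Complex.exp_add,
      ← Complex.exp_add, ← Complex.exp_add]
    congr 2
    · push_cast; ring
    · push_cast; ring
  simp_rw [h1]
  rw [intervalIntegral.integral_sub
    (Continuous.intervalIntegrable (by fun_prop) _ _)
    (Continuous.intervalIntegrable (by fun_prop) _ _), aux_integral ha, aux_integral ha]
  have e1 := auxU_sub ha k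
  have e2 := auxU_sub ha (k - 1)
  have e3 : (k : ℂ) - a ≠ 0 := by rw [← neg_sub]; exact neg_ne_zero.mpr e1
  have e4 : (k : ℂ) - 1 - a ≠ 0 := by
    have := neg_ne_zero.mpr e2; push_cast at this; rwa [neg_sub] at this
  push_cast at e2 ⊢
  have e5 : (Real.pi : ℂ) ≠ 0 := by exact_mod_cast Real.pi_ne_zero
  have i1 : (a - k)⁻¹ = -((k : ℂ) - a)⁻¹ := by rw [← inv_neg, neg_sub]
  have i2 : (a - (k - 1))⁻¹ = -((k : ℂ) - 1 - a)⁻¹ := by rw [← inv_neg, neg_sub]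
  simp only [div_eq_mul_inv, mul_inv, i1, i2]
  simp
  ring

lemma aux_int_summable (a : ℂ) :
    Summable fun k : ℤ => ((k : ℂ) - a)⁻¹ - ((k : ℂ) - 1 - a)⁻¹ := by
  apply Summable.of_nat_of_neg_add_one
  · refine (aux_summable (-1 - a)).congr fun n => ?_
    push_cast
    congr 2 <;> ring
  · refine (aux_summable (1 + a)).congr fun n => ?_
    have i1 : (((-((n : ℤ) + 1) : ℤ) : ℂ) - a)⁻¹ = -((n : ℂ) + (1 + a))⁻¹ := by
      rw [← inv_neg]; congr 1; push_cast; ring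
    have i2 : (((-((n : ℤ) + 1) : ℤ) : ℂ) - 1 - a)⁻¹ = -((n : ℂ) + 1 + (1 + a))⁻¹ := by
      rw [← inv_neg]; congr 1; push_cast; ring
    rw [i1, i2]; ring

lemma aux_fourier {a : ℂ} (ha : a ∈ auxU) (t : ℝ) (ht : t ∈ Set.Ico (0 : ℝ) 1) (x : ℂ)
    (hx : x = Complex.exp (2 * Real.pi * Complex.I * t)) :
    HasSum (fun k : ℤ => x ^ k * (((k : ℂ) - a)⁻¹ - ((k : ℂ) - 1 - a)⁻¹))
      (-(2 * Real.pi * Complex.I) / (Complex.exp (2 * Real.pi * Complex.I * a) - 1)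
        * auxh a t) := by
  have hT : Fact ((0 : ℝ) < 1) := ⟨zero_lt_one⟩
  have hend : auxh a 0 = auxh a 1 := by simp [auxh, Complex.exp_two_pi_mul_I]
  let B : C(AddCircle (1 : ℝ), ℂ) :=
    ⟨AddCircle.liftIco 1 0 (auxh a),
      AddCircle.liftIco_zero_continuous hend (auxh_cont a).continuousOn⟩
  have step1 : ∀ k : ℤ, fourierCoeff B k
      = -(Complex.exp (2 * Real.pi * Complex.I * a) - 1) / (2 * Real.pi * Complex.I)
        * (((k : ℂ) - a)⁻¹ - ((k : ℂ) - 1 - a)⁻¹) := by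
    intro k
    have h := fourierCoeff_liftIco_eq (T := 1) (a := 0) (auxh a) k
    rw [← aux_coeff ha k]
    change fourierCoeff (AddCircle.liftIco 1 0 (auxh a)) k = _
    rw [h]
    congr 1
    simp
  have step2 := has_pointwise_sum_fourier_series_of_summable (f := B)
    (((aux_int_summable a).mul_left _).congr fun k => (step1 k).symm) (t : AddCircle (1 : ℝ))
  have hB : B (t : AddCircle (1 : ℝ)) = auxh a t :=
    AddCircle.liftIco_zero_coe_apply (f := auxh a) ht
  rw [hB] at step2
  have step3 := step2.mul_left
    (-(2 * Real.pi * Complex.I) / (Complex.exp (2 * Real.pi * Complex.I * a) - 1))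
  refine step3.congr_fun ?_ 
  intro k
  rw [step1, smul_eq_mul, fourier_coe_apply, hx, ← Complex.exp_int_mul]
  have := aux_E_ne ha
  have := Complex.two_pi_I_ne_zero
  have e : (2 * Real.pi * Complex.I * k * t / (1 : ℝ) : ℂ) = k * (2 * Real.pi * Complex.I * t) := by
    push_cast; ring
  rw [e]
  generalize Complex.exp (2 * Real.pi * Complex.I * a) - 1 = E at *
  generalize (2 * Real.pi * Complex.I : ℂ) = Q at *
  field_simp

lemma aux_tele (x y : ℂ) (hxy : x * y = 1) (g : ℤ → ℂ) (N : ℕ) :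
    ∑ n ∈ range N, (x ^ n * (g n - g (n - 1)) + y ^ (n + 1) * (g (-(n + 1)) - g (-(n + 1) - 1)))
      = (1 - x) * (x * ∑ n ∈ range N, x ^ n * g (n + 1) + ∑ n ∈ range N, y ^ n * g (-n))
        - (1 - x) * (x ^ N * g N - y ^ N * g (-N)) + x ^ N * g (N - 1)
        - y ^ N * g (-(N + 1)) := by
  induction N with
  | zero => simp
  | succ N ih =>
    simp only [sum_range_succ]
    rw [ih]
    have e1 : (((N + 1 : ℕ) : ℤ)) = (N : ℤ) + 1 := by push_cast; ring
    have e2 : (N : ℤ) + 1 - 1 = N := by ring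
    have e3 : -((N : ℤ) + 1) - 1 = -((N : ℤ) + 1 + 1) := by ring
    rw [e1, e2, e3]
    linear_combination (y ^ N * g (-((N : ℤ) + 1))) * hxy

lemma aux_trig {a : ℂ} (ha : a ∈ auxU) :
    (Real.pi : ℂ) * (Complex.I - Complex.cos (Real.pi * a) / Complex.sin (Real.pi * a))
      = -(2 * Real.pi * Complex.I) / (Complex.exp (2 * Real.pi * Complex.I * a) - 1) := by
  have hE := aux_E_ne ha
  have h2 : Complex.exp (2 * Real.pi * Complex.I * a)
      = Complex.exp (Real.pi * a * Complex.I) ^ 2 := by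
    rw [← Complex.exp_nat_mul]; congr 1; push_cast; ring
  rw [h2] at hE ⊢
  rw [Complex.cos, Complex.sin, neg_mul, Complex.exp_neg]
  have hu : Complex.exp (Real.pi * a * Complex.I) ≠ 0 := Complex.exp_ne_zero _
  generalize Complex.exp (Real.pi * a * Complex.I) = u at *
  have hE' : u⁻¹ - u ≠ 0 := by
    intro h; apply hE; field_simp at h; linear_combination -h
  have hE'' : 1 - u ^ 2 ≠ 0 := by
    intro h; apply hE; linear_combination -h
  have hI := Complex.I_ne_zero
  have hII := Complex.I_sq
  have k1 : (u + u⁻¹) / 2 / ((u⁻¹ - u) * Complex.I / 2) 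
      = -Complex.I * (u ^ 2 + 1) / (1 - u ^ 2) := by
    rw [div_eq_div_iff (by simp [hE']) hE'']
    field_simp
    linear_combination (1 + u ^ 2) * hII
  rw [k1]
  rw [eq_div_iff hE]
  field_simp
  ring

lemma aux_zero {a : ℂ} (ha : a ∈ auxU) (θ : ℝ) (hθ : θ ∈ Set.Ioo 0 (2 * Real.pi)) (x : ℂ)
    (hx : x = Complex.exp (Complex.I * θ)) (hxn : ‖x‖ = 1) (hx1 : x ≠ 1) (g1 g2 : ℂ)
    (h1 : Tendsto (fun N : ℕ => ∑ n ∈ range N, x ^ n * ((n : ℂ) + (1 - a))⁻¹) atTop (nhds g1))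
    (h2 : Tendsto (fun N : ℕ => ∑ n ∈ range N, x⁻¹ ^ n * ((n : ℂ) + a)⁻¹) atTop (nhds g2)) :
    x * g1 - g2 = Real.pi * (Complex.I * Complex.exp (Complex.I * a * θ)
      - Complex.cos (Real.pi * a) / Complex.sin (Real.pi * a)
        * Complex.exp (Complex.I * a * θ)) := by
  have hpi := Real.pi_pos
  have hpc : (Real.pi : ℂ) ≠ 0 := by exact_mod_cast hpi.ne'
  have hx0 : x ≠ 0 := by rw [hx]; exact Complex.exp_ne_zero _
  have hyn : ‖x⁻¹‖ = 1 := by rw [norm_inv, hxn, inv_one]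
  have hF := aux_fourier ha (θ / (2 * Real.pi)) ⟨by have := hθ.1; positivity, by
    rw [div_lt_one (by positivity)]; exact hθ.2⟩ x (by
      rw [hx]; congr 1; push_cast; field_simp)
  have hF2 := hF.nat_add_neg_add_one.tendsto_sum_nat
  have key : ∀ N : ℕ, ∑ n ∈ range N,
      (x ^ (n : ℤ) * ((((n : ℤ) : ℂ) - a)⁻¹ - (((n : ℤ) : ℂ) - 1 - a)⁻¹)
        + x ^ (-((n : ℤ) + 1)) * ((((-((n : ℤ) + 1) : ℤ) : ℂ) - a)⁻¹
          - (((-((n : ℤ) + 1) : ℤ) : ℂ) - 1 - a)⁻¹))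
      = (1 - x) * (x * ∑ n ∈ range N, x ^ n * ((n : ℂ) + (1 - a))⁻¹
          - ∑ n ∈ range N, x⁻¹ ^ n * ((n : ℂ) + a)⁻¹)
        - (1 - x) * (x ^ N * ((N : ℂ) + (-a))⁻¹ + x⁻¹ ^ N * ((N : ℂ) + a)⁻¹)
        + x ^ N * ((N : ℂ) + (-1 - a))⁻¹ + x⁻¹ ^ N * ((N : ℂ) + (1 + a))⁻¹ := by
    intro N
    have := aux_tele x x⁻¹ (mul_inv_cancel₀ hx0) (fun k => ((k : ℂ) - a)⁻¹) N
    have hneg : ∀ n : ℕ, (-(n : ℂ) - a)⁻¹ = -((n : ℂ) + a)⁻¹ := by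
      intro n; rw [← inv_neg]; congr 1; ring
    have hneg1 : ∀ n : ℕ, (-((n : ℂ) + 1) - a)⁻¹ = -((n : ℂ) + (1 + a))⁻¹ := by
      intro n; rw [← inv_neg]; congr 1; ring
    have hp : ∀ n : ℕ, ((n : ℂ) + 1 - a)⁻¹ = ((n : ℂ) + (1 - a))⁻¹ := by
      intro n; congr 1; ring
    have hp1 : ∀ n : ℕ, ((n : ℂ) - 1 - a)⁻¹ = ((n : ℂ) + (-1 - a))⁻¹ := by
      intro n; congr 1; ring
    have hz : ∀ n : ℕ, x ^ (-((n : ℤ) + 1)) = x⁻¹ ^ (n + 1) := by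
      intro n; rw [zpow_neg, inv_pow, ← Nat.cast_succ, zpow_natCast]
    push_cast at this ⊢
    simp only [hneg, hneg1, hp, hp1, mul_neg, sum_neg_distrib] at this
    simp only [zpow_natCast, hz, hneg1, hp1]
    rw [this]
    rw [sub_eq_add_neg (N : ℂ) a]
    ring
  have hlim := (((((h1.const_mul x).sub h2).const_mul (1 - x)).sub
    (((aux_inv_tendsto x (-a) hxn).add (aux_inv_tendsto x⁻¹ a hyn)).const_mul (1 - x))).add
    (aux_inv_tendsto x (-1 - a) hxn)).add (aux_inv_tendsto x⁻¹ (1 + a) hyn)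
  have heq := tendsto_nhds_unique (hF2.congr key) hlim
  have hx2 : 1 - x ≠ 0 := sub_ne_zero.mpr hx1.symm
  apply mul_left_cancel₀ hx2
  rw [← sub_mul, ← mul_assoc (Real.pi : ℂ), aux_trig ha]
  have e1 : auxh a (θ / (2 * Real.pi)) = (1 - x) * Complex.exp (Complex.I * a * θ) := by
    rw [auxh, hx]
    have k1 : (2 * Real.pi * Complex.I * ((θ / (2 * Real.pi) : ℝ) : ℂ)) = Complex.I * θ := by
      push_cast; field_simp
    have k2 : (2 * Real.pi * Complex.I * a * ((θ / (2 * Real.pi) : ℝ) : ℂ))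
        = Complex.I * a * θ := by
      push_cast; field_simp
    rw [k1, k2]
  rw [e1] at heq
  linear_combination -heq

lemma aux_main (θ : ℝ) (hθ : θ ∈ Set.Ioo 0 (2 * Real.pi))
    (x : ℂ) (hx : x = Complex.exp (Complex.I * θ))
    (a : ℂ) (ha : a ∈ auxU) (m : ℕ) :
    ∃ L1 L2 : ℂ,
      Tendsto (fun N : ℕ => ∑ n ∈ Finset.Icc 1 N, x ^ n / ((n : ℂ) - a) ^ (m + 1))
        atTop (nhds L1) ∧
      Tendsto (fun N : ℕ => ∑ n ∈ Finset.Icc 1 N, x⁻¹ ^ n / ((n : ℂ) + a - 1) ^ (m + 1))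
        atTop (nhds L2) ∧
      L1 - (-1 : ℂ) ^ m * x * L2
        = ((Real.pi : ℂ) / (m.factorial : ℂ))
          * iteratedDeriv m
              (fun w : ℂ => Complex.I * Complex.exp (Complex.I * w * (θ : ℂ))
                - (Complex.cos ((Real.pi : ℂ) * w) / Complex.sin ((Real.pi : ℂ) * w))
                  * Complex.exp (Complex.I * w * (θ : ℂ))) a := by
  have hx0 : x ≠ 0 := by rw [hx]; exact Complex.exp_ne_zero _
  have hxn : ‖x‖ = 1 := by rw [hx, mul_comm]; exact Complex.norm_exp_ofReal_mul_I θ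
  have hyn : ‖x⁻¹‖ = 1 := by rw [norm_inv, hxn, inv_one]
  have hx1 : x ≠ 1 := by
    intro h
    rw [hx] at h
    obtain ⟨n, hn⟩ := Complex.exp_eq_one_iff.mp h
    have h3 : (θ : ℂ) = n * (2 * Real.pi) := by
      apply mul_left_cancel₀ Complex.I_ne_zero
      rw [hn]; ring
    have h4 : θ = n * (2 * Real.pi) := by exact_mod_cast h3
    have hpi := Real.pi_pos
    have h5 := hθ.1
    have h6 := hθ.2
    rw [h4] at h5 h6
    have h7 : (0 : ℝ) < n := by
      by_contra hc
      push Not at hc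
      nlinarith
    have h8 : (n : ℝ) < 1 := by
      by_contra hc
      push Not at hc
      nlinarith
    have h9 : (0 : ℤ) < n := by exact_mod_cast h7
    have h10 : n < (1 : ℤ) := by exact_mod_cast h8
    omega
  have hy1 : x⁻¹ ≠ 1 := by simpa using hx1
  have hU1 : ∀ w ∈ auxU, 1 - w ∈ auxU := by
    rintro w hw ⟨n, hn⟩
    exact hw ⟨1 - n, by push_cast; rw [hn]; ring⟩
  obtain ⟨G1, hd1, hG1⟩ := aux_all x hxn hx1
  obtain ⟨G2, hd2, hG2⟩ := aux_all x⁻¹ hyn hy1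
  have hid : ∀ w ∈ auxU, x * G1 (1 - w) - G2 w
      = Real.pi * (Complex.I * Complex.exp (Complex.I * w * θ)
      - Complex.cos (Real.pi * w) / Complex.sin (Real.pi * w)
        * Complex.exp (Complex.I * w * θ)) := by
    intro w hw
    refine aux_zero hw θ hθ x hx hxn hx1 _ _ ?_ ?_
    · simpa using (hG1 0).tendsto_at (hU1 w hw)
    · simpa using (hG2 0).tendsto_at hw
  have t1 := ((hG1 m).tendsto_at (hU1 a ha)).const_mul x
  have t2 := ((hG2 m).tendsto_at ha).const_mul x⁻¹
  refine ⟨_, _, t1.congr fun N => ?_, t2.congr fun N => ?_, ?_⟩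
  · induction N with
    | zero => simp
    | succ N ih =>
      have e : ((N + 1 : ℕ) : ℂ) - a = N + (1 - a) := by push_cast; ring
      rw [sum_range_succ, mul_add, ih, Finset.sum_Icc_succ_top (by omega), e, pow_succ x N,
        div_eq_mul_inv]
      ring
  · induction N with
    | zero => simp
    | succ N ih =>
      have e : ((N + 1 : ℕ) : ℂ) + a - 1 = N + a := by push_cast; ring
      rw [sum_range_succ, mul_add, ih, Finset.sum_Icc_succ_top (by omega), e, pow_succ x⁻¹ N,
        div_eq_mul_inv]
      ring
  have hn : auxU ∈ nhds a := auxU_open.mem_nhds ha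
  have hn1 : auxU ∈ nhds (1 - a) := auxU_open.mem_nhds (hU1 a ha)
  have c1 : ContDiffAt ℂ m G1 (1 - a) := (hd1.analyticAt hn1).contDiffAt
  have c2 : ContDiffAt ℂ m G2 a := (hd2.analyticAt hn).contDiffAt
  have c1' : ContDiffAt ℂ m (fun w => G1 (1 - w)) a :=
    ContDiffAt.comp a (f := fun w : ℂ => 1 - w) c1 (by fun_prop)
  have hev : (fun w => x * G1 (1 - w) - G2 w) =ᶠ[nhds a] fun w =>
      Real.pi * (Complex.I * Complex.exp (Complex.I * w * θ)
      - Complex.cos (Real.pi * w) / Complex.sin (Real.pi * w)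
        * Complex.exp (Complex.I * w * θ)) := by
    filter_upwards [hn] with w hw using hid w hw
  have hder := hev.iteratedDeriv_eq m
  rw [iteratedDeriv_const_mul_field, iteratedDeriv_fun_sub (contDiffAt_const.mul c1') c2,
    iteratedDeriv_const_mul_field, iteratedDeriv_comp_const_sub] at hder
  rw [div_mul_eq_mul_div (Real.pi : ℂ), ← hder]
  have hf : (m.factorial : ℂ) ≠ 0 := by exact_mod_cast m.factorial_ne_zero
  have hs : ((-1 : ℂ) ^ m) * (-1) ^ m = 1 := by rw [← mul_pow]; simp
  simp only [smul_eq_mul]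
  field_simp
  linear_combination (-iteratedDeriv m G2 a) * hs

/-- Theorem `thm-main-two`: `Li_{m+1}(x;1−a) − (−1)^m x Li_{m+1}(x⁻¹;a)` is the m-th derivative
of `w ↦ i x^w − cot(πw) x^w` (times `π/m!`), where `x = e^{iθ}`. -/
theorem li_reflection_deriv (θ : ℝ) (hθ : θ ∈ Set.Ioo 0 (2 * Real.pi))
    (x : ℂ) (hx : x = Complex.exp (Complex.I * θ))
    (a : ℂ) (ha : ∀ z : ℤ, a ≠ (z : ℂ)) (m : ℕ) :
    ∃ L1 L2 : ℂ,
      Tendsto (fun N : ℕ => ∑ n ∈ Finset.Icc 1 N, x ^ n / ((n : ℂ) - a) ^ (m + 1))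
        atTop (nhds L1) ∧
      Tendsto (fun N : ℕ => ∑ n ∈ Finset.Icc 1 N, x⁻¹ ^ n / ((n : ℂ) + a - 1) ^ (m + 1))
        atTop (nhds L2) ∧
      L1 - (-1 : ℂ) ^ m * x * L2
        = ((Real.pi : ℂ) / (m.factorial : ℂ))
          * iteratedDeriv m
              (fun w : ℂ => Complex.I * Complex.exp (Complex.I * w * (θ : ℂ))
                - (Complex.cos ((Real.pi : ℂ) * w) / Complex.sin ((Real.pi : ℂ) * w))
                  * Complex.exp (Complex.I * w * (θ : ℂ))) a := by
  refine aux_main θ hθ x hx a ?_ m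
  rintro ⟨z, hz⟩
  exact ha z hz.symm
end

section
/- Let θ ∈ (0, 2π), x := e^{iθ}, and a ∈ ℂ∖ℤ. Then lim_{N→∞} Σ_{n=1}^{N} x^n/(n−a) − x · lim_{N→∞} Σ_{n=1}^{N} x^{−n}/(n+a−1) = −π cot(πa) e^{iaθ} + π i e^{iaθ}, where cot(πa) = cos(πa)/sin(πa) and i is the imaginary unit; in particular both limits of partial sums exist. -/
open Filter Finset

lemma rl_aux (g : ℝ → ℂ) (u : ℕ → ℤ)
    (hu : Tendsto (fun n => |(u n : ℝ)|) atTop atTop) :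
    Tendsto (fun n : ℕ => ∫ t in (0:ℝ)..(2 * Real.pi),
      g t * Complex.exp (-(Complex.I * (u n : ℂ) * t))) atTop (nhds 0) := by
  have h := Real.tendsto_integral_exp_smul_cocompact
    (Set.indicator (Set.Ioc 0 (2 * Real.pi)) g)
  have hw : Tendsto (fun n : ℕ => (u n : ℝ) / (2 * Real.pi)) atTop (cocompact ℝ) := by
    rw [← Metric.cobounded_eq_cocompact, ← comap_norm_atTop, tendsto_comap_iff]
    have : (norm ∘ fun n : ℕ => (u n : ℝ) / (2 * Real.pi))
        = fun n => |(u n : ℝ)| / (2 * Real.pi) := by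
      funext n
      simp [abs_of_pos Real.pi_pos]
    rw [this]
    exact hu.atTop_div_const (by positivity)
  refine (h.comp hw).congr fun n => ?_
  rw [intervalIntegral.integral_of_le (by positivity), ← MeasureTheory.integral_indicator
    measurableSet_Ioc]
  simp only [Function.comp]
  congr 1
  funext v
  by_cases hv : v ∈ Set.Ioc 0 (2 * Real.pi)
  · simp only [Set.indicator_of_mem hv, Circle.smul_def, Real.fourierChar_apply, smul_eq_mul]
    rw [mul_comm]
    congr 2
    have : (Real.pi : ℂ) ≠ 0 := by exact_mod_cast Real.pi_ne_zero
    push_cast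
    field_simp
  · simp [Set.indicator_of_notMem hv]

lemma exists_quot (θ : ℝ) (hθ : θ ∈ Set.Ioo 0 (2 * Real.pi)) (a : ℂ) :
    ∃ g : ℝ → ℂ, ContinuousOn g (Set.Icc 0 (2 * Real.pi)) ∧
      ∀ t : ℝ, t ∈ Set.Icc 0 (2 * Real.pi) →
        g t * (Complex.exp (Complex.I * t) - Complex.exp (Complex.I * θ))
        = Complex.exp (Complex.I * a * t) - Complex.exp (Complex.I * a * θ) := by
  have hd : ∀ b : ℂ, ∀ t : ℝ, HasDerivAt (fun t : ℝ => Complex.exp (b * t))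
      (Complex.exp (b * t) * b) t := by
    intro b t
    have h1 : HasDerivAt (fun t : ℝ => b * (t : ℂ)) b t := by
      simpa using (Complex.ofRealCLM.hasDerivAt (x := t)).const_mul b
    exact h1.cexp
  have hc : ∀ b : ℂ, Continuous (dslope (fun t : ℝ => Complex.exp (b * t)) θ) := by
    intro b
    rw [← continuousOn_univ, continuousOn_dslope univ_mem]
    exact ⟨by fun_prop, (hd b θ).differentiableAt⟩
  have hm : ∀ b : ℂ, ∀ t : ℝ, ((t - θ : ℝ) : ℂ) * dslope (fun t : ℝ => Complex.exp (b * t)) θ t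
      = Complex.exp (b * t) - Complex.exp (b * θ) := by
    intro b t
    have := sub_smul_dslope (fun t : ℝ => Complex.exp (b * t)) θ t
    rw [← this, Complex.real_smul]
  have hne : ∀ t ∈ Set.Icc 0 (2 * Real.pi),
      dslope (fun t : ℝ => Complex.exp (Complex.I * t)) θ t ≠ 0 := by
    intro t ht h0
    by_cases htt : t = θ
    · subst htt
      rw [dslope_same, (hd _ _).deriv] at h0
      simp at h0
    · have h1 := hm Complex.I t
      rw [h0, mul_zero] at h1
      have h2 := sub_eq_zero.1 h1.symm
      rw [Complex.exp_eq_exp_iff_exists_int] at h2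
      obtain ⟨n, hn⟩ := h2
      have h3 : Complex.I * ((t : ℂ) - (θ + n * (2 * Real.pi))) = 0 := by
        linear_combination hn
      have h4 := (mul_eq_zero.1 h3).resolve_left Complex.I_ne_zero
      have h5 : t - (θ + n * (2 * Real.pi)) = 0 := by exact_mod_cast h4
      obtain ⟨ha1, ha2⟩ := hθ
      obtain ⟨hb1, hb2⟩ := ht
      have hp := Real.pi_pos
      have hn1 : (n : ℝ) < 1 := by
        by_contra! hh
        nlinarith
      have hn2 : (-1 : ℝ) < n := by
        by_contra! hh
        nlinarith
      have hn0 : n = 0 := by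
        have h6 : n < 1 := by exact_mod_cast hn1
        have h7 : -1 < n := by exact_mod_cast hn2
        omega
      subst hn0
      apply htt
      simp at h5
      linarith
  refine ⟨fun t => dslope (fun t : ℝ => Complex.exp (Complex.I * a * t)) θ t /
    dslope (fun t : ℝ => Complex.exp (Complex.I * t)) θ t,
    (hc _).continuousOn.div (hc _).continuousOn hne, fun t ht => ?_⟩
  rw [← hm, ← hm]
  field_simp [hne t ht]

lemma int_exp (b : ℂ) (hb : b ≠ 0) : ∫ t in (0:ℝ)..(2 * Real.pi), Complex.exp (b * t)
    = (Complex.exp (b * (2 * Real.pi)) - 1) / b := by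
  rw [integral_exp_mul_complex hb]
  simp

lemma exp_per (n : ℤ) : Complex.exp (-(Complex.I * n * (2 * Real.pi))) = 1 := by
  rw [Complex.exp_eq_one_iff]
  exact ⟨-n, by push_cast; ring⟩

/-- The depth-one reflection formula `Li_1(x;1−a) − x Li_1(x⁻¹;a) = −π cot(πa) e^{iaθ} + πi e^{iaθ}`
for `x = e^{iθ}`, `θ ∈ (0, 2π)`, `a ∈ ℂ∖ℤ`. -/
theorem li1_reflection (θ : ℝ) (hθ : θ ∈ Set.Ioo 0 (2 * Real.pi))
    (x : ℂ) (hx : x = Complex.exp (Complex.I * θ))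
    (a : ℂ) (ha : ∀ z : ℤ, a ≠ (z : ℂ)) :
    ∃ L1 L2 : ℂ,
      Tendsto (fun N : ℕ => ∑ n ∈ Finset.Icc 1 N, x ^ n / ((n : ℂ) - a)) atTop (nhds L1) ∧
      Tendsto (fun N : ℕ => ∑ n ∈ Finset.Icc 1 N, x⁻¹ ^ n / ((n : ℂ) + a - 1)) atTop (nhds L2) ∧
      L1 - x * L2
        = -(Real.pi : ℂ) * (Complex.cos ((Real.pi : ℂ) * a) / Complex.sin ((Real.pi : ℂ) * a))
            * Complex.exp (Complex.I * a * (θ : ℂ))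
          + (Real.pi : ℂ) * Complex.I * Complex.exp (Complex.I * a * (θ : ℂ)) := by
  obtain ⟨g, hgc, hg⟩ := exists_quot θ hθ a
  have hpi : (0:ℝ) ≤ 2 * Real.pi := by positivity
  have hx0 : x ≠ 0 := by rw [hx]; exact Complex.exp_ne_zero _
  have hxn : ‖x‖ = 1 := by rw [hx, mul_comm]; exact Complex.norm_exp_ofReal_mul_I θ
  set F := Complex.exp (Complex.I * a * θ) with hF
  set E := Complex.exp (Complex.I * a * (2 * Real.pi)) with hE
  obtain ⟨G, hG⟩ : ∃ G : ℤ → ℂ, G = fun n : ℤ => ∫ t in (0:ℝ)..(2 * Real.pi),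
      g t * Complex.exp (-(Complex.I * (n : ℂ) * t)) := ⟨_, rfl⟩
  have hE1 : E - 1 ≠ 0 := by
    intro h
    have h1 := sub_eq_zero.1 h
    rw [hE, Complex.exp_eq_one_iff] at h1
    obtain ⟨n, hn⟩ := h1
    apply ha n
    have : (Real.pi : ℂ) ≠ 0 := by exact_mod_cast Real.pi_ne_zero
    have h2 : (2 * Real.pi * Complex.I) * (a - n) = 0 := by linear_combination hn
    have := (mul_eq_zero.1 h2).resolve_left (by simp [this])
    exact sub_eq_zero.1 this
  have hint : ∀ n : ℤ, IntervalIntegrable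
      (fun t : ℝ => g t * Complex.exp (-(Complex.I * (n : ℂ) * t))) MeasureTheory.volume
      0 (2 * Real.pi) := by
    intro n
    apply ContinuousOn.intervalIntegrable
    rw [Set.uIcc_of_le hpi]
    exact hgc.mul (by fun_prop)
  have hrec : ∀ n : ℤ, G (n - 1) - x * G n = (E - 1) / (Complex.I * (a - n))
      - F * ∫ t in (0:ℝ)..(2 * Real.pi), Complex.exp (-(Complex.I * (n : ℂ)) * t) := by
    intro n
    have hb : Complex.I * (a - n) ≠ 0 :=
      mul_ne_zero Complex.I_ne_zero (sub_ne_zero.2 (ha n))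
    have h1 := int_exp (Complex.I * (a - n)) hb
    have h2 : Complex.exp (Complex.I * (a - n) * (2 * Real.pi)) = E := by
      rw [hE, ← mul_one (Complex.exp (Complex.I * a * _)), ← exp_per n, ← Complex.exp_add]
      congr 1
      ring
    rw [h2] at h1
    rw [← h1, hG]
    simp only
    rw [← intervalIntegral.integral_const_mul, ← intervalIntegral.integral_const_mul,
      ← intervalIntegral.integral_sub (hint _) ((hint _).const_mul _),
      ← intervalIntegral.integral_sub]
    · apply intervalIntegral.integral_congr
      intro t ht
      rw [Set.uIcc_of_le hpi] at ht
      have h3 := hg t ht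
      rw [← hx] at h3
      have e1 : Complex.exp (-(Complex.I * ((n - 1 : ℤ) : ℂ) * t))
          = Complex.exp (Complex.I * t) * Complex.exp (-(Complex.I * n * t)) := by
        rw [← Complex.exp_add]; congr 1; push_cast; ring
      have e2 : Complex.exp (Complex.I * (a - n) * t)
          = Complex.exp (Complex.I * a * t) * Complex.exp (-(Complex.I * n * t)) := by
        rw [← Complex.exp_add]; congr 1; ring
      have e3 : -(Complex.I * (n : ℂ)) * t = -(Complex.I * n * t) := by ring
      simp only [e1, e2, e3]
      linear_combination Complex.exp (-(Complex.I * n * t)) * h3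
    · exact Continuous.intervalIntegrable (by fun_prop) _ _
    · exact Continuous.intervalIntegrable (by fun_prop) _ _
  have hrec0 : G (-1) - x * G 0 = (E - 1) / (Complex.I * a) - F * (2 * Real.pi) := by
    have := hrec 0
    simpa using this
  have hrecn : ∀ n : ℤ, n ≠ 0 → G (n - 1) - x * G n = (E - 1) / (Complex.I * (a - n)) := by
    intro n hn
    rw [hrec, int_exp]
    · rw [neg_mul, exp_per]; simp
    · simpa using hn
  have hI := Complex.I_ne_zero
  have hs1 : ∀ N : ℕ, ∑ n ∈ Finset.Icc 1 N, x ^ n / ((n : ℂ) - a)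
      = -Complex.I * (x * G 0 - x ^ (N + 1) * G N) / (E - 1) := by
    intro N
    induction N with
    | zero => simp
    | succ N ih =>
      rw [Finset.sum_Icc_succ_top (by omega), ih]
      have h := hrecn (N + 1) (by omega)
      have h1 : a - ((N + 1 : ℤ) : ℂ) ≠ 0 := sub_ne_zero.2 (ha _)
      have h2 : ((N + 1 : ℕ) : ℂ) - a ≠ 0 := by
        rw [← neg_ne_zero]; simpa using h1
      simp only [add_sub_cancel_right] at h
      rw [eq_div_iff (mul_ne_zero hI h1)] at h
      field_simp
      push_cast at h ⊢
      linear_combination (-x ^ (N + 1)) * h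
  have hs2 : ∀ N : ℕ, ∑ n ∈ Finset.Icc 1 (N + 1), x⁻¹ ^ n / ((n : ℂ) + a - 1)
      = Complex.I * (x⁻¹ ^ (N + 1) * G (-(N + 1 : ℕ)) - G 0 + x⁻¹ * (F * (2 * Real.pi)))
        / (E - 1) := by
    intro N
    have ha0 : a ≠ 0 := by simpa using ha 0
    induction N with
    | zero =>
      have h := hrec0
      simp only [zero_add, Finset.Icc_self, Finset.sum_singleton, pow_one, Nat.cast_one,
        add_sub_cancel_left]
      have hz : x⁻¹ * x = 1 := inv_mul_cancel₀ hx0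
      generalize x⁻¹ = z at *
      generalize G (-1) = p at *
      rw [sub_eq_iff_eq_add] at h
      rw [h, div_eq_div_iff ha0 hE1]
      field_simp
      linear_combination (-Complex.I * a * G 0) * hz
    | succ N ih =>
      rw [Finset.sum_Icc_succ_top (by omega), ih]
      have h := hrecn (-(N + 1 : ℕ)) (by omega)
      have h1 : a - ((-(N + 1 : ℕ) : ℤ) : ℂ) ≠ 0 := sub_ne_zero.2 (ha _)
      have h2 : ((N + 1 + 1 : ℕ) : ℂ) + a - 1 ≠ 0 := by
        convert h1 using 1; push_cast; ring
      have h3 : (-(N + 1 : ℕ) - 1 : ℤ) = -((N + 1 + 1 : ℕ) : ℤ) := by push_cast; ring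
      rw [h3, eq_div_iff (mul_ne_zero hI h1)] at h
      have hxp : x⁻¹ ^ (N + 1 + 1) * x = x⁻¹ ^ (N + 1) := by
        rw [pow_succ, mul_assoc, inv_mul_cancel₀ hx0, mul_one]
      rw [← hxp]
      generalize x⁻¹ ^ (N + 1 + 1) = y at *
      generalize x⁻¹ = z at *
      generalize G (-((N + 1 + 1 : ℕ) : ℤ)) = p at *
      generalize G (-((N + 1 : ℕ) : ℤ)) = q at *
      rw [div_add_div _ _ hE1 h2, div_eq_div_iff (mul_ne_zero hE1 h2) hE1]
      push_cast at h ⊢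
      linear_combination (-y * (E - 1)) * h
  have hbd : ∀ (y : ℂ) (_ : ‖y‖ = 1) (H : ℕ → ℂ) (_ : Tendsto H atTop (nhds 0)),
      Tendsto (fun N => y ^ (N + 1) * H N) atTop (nhds 0) := by
    intro y hy H hH
    rw [tendsto_zero_iff_norm_tendsto_zero] at hH ⊢
    simpa [hy] using hH
  have ht1 : Tendsto (fun N : ℕ => G N) atTop (nhds 0) := by
    rw [hG]
    refine rl_aux g (fun n : ℕ => (n : ℤ)) ?_
    simpa using tendsto_natCast_atTop_atTop
  have ht2 : Tendsto (fun N : ℕ => G (-(N + 1 : ℕ))) atTop (nhds 0) := by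
    rw [hG]
    refine rl_aux g (fun n : ℕ => -((n + 1 : ℕ) : ℤ)) ?_
    have : (fun n : ℕ => |((-((n + 1 : ℕ) : ℤ) : ℤ) : ℝ)|) = fun n : ℕ => (n : ℝ) + 1 := by
      funext n
      rw [Int.cast_neg, abs_neg]
      push_cast
      exact abs_of_nonneg (by positivity)
    rw [this]
    exact tendsto_atTop_add_const_right _ _ tendsto_natCast_atTop_atTop
  refine ⟨-Complex.I * (x * G 0 - 0) / (E - 1),
    Complex.I * (0 - G 0 + x⁻¹ * (F * (2 * Real.pi))) / (E - 1), ?_, ?_, ?_⟩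
  · simp_rw [hs1]
    exact ((tendsto_const_nhds.sub (hbd x hxn _ ht1)).const_mul _).div_const _
  · rw [← tendsto_add_atTop_iff_nat 1]
    simp_rw [hs2]
    exact ((((hbd x⁻¹ (by simp [hxn]) _ ht2).sub_const _).add_const _).const_mul _).div_const _
  · obtain ⟨w, hw⟩ : ∃ w, w = Complex.exp (Real.pi * a * Complex.I) := ⟨_, rfl⟩
    have hw0 : w ≠ 0 := hw ▸ Complex.exp_ne_zero _
    have hEw : E = w ^ 2 := by
      rw [hE, hw, ← Complex.exp_nat_mul]; congr 1; push_cast; ring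
    have hwn : Complex.exp (-(Real.pi * a) * Complex.I) = w⁻¹ := by
      rw [hw, ← Complex.exp_neg]; congr 1; ring
    rw [Complex.cos, Complex.sin, hwn, ← hw]
    rw [hEw] at hE1 ⊢
    have hs : (w⁻¹ - w) * Complex.I / 2 = -(w ^ 2 - 1) * Complex.I / (2 * w) := by
      field_simp
      ring
    rw [hs]
    generalize G 0 = q at *
    clear_value F
    field_simp
    ring_nf
    simp only [Complex.I_sq]
    ring
end

section
/- Let x be a root of unity and let a, b ∈ ℂ∖ℤ with b − a ∉ {−1,−2,−3,…}. Then Li_{2,2}(x^{−1}, x; a, b) + Li_{2,2}(x^{−1}, x; 1−b, 1−a) + x^{−1} Li_2(x; b) Li_2(x; 1−a) = π² (csc²(πa) + csc²(πb)) Li_2(x; 1+b−a) + 2π (cot(πb) − cot(πa)) Li_3(x; 1+b−a), where csc(w) = 1/sin(w) and cot(w) = cos(w)/sin(w). -/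
open Filter Finset

open Topology in
theorem aux_ne {a : ℂ} (ha : ∀ z : ℤ, a ≠ (z : ℂ)) (n : ℤ) : (n : ℂ) + a ≠ 0 := by
  intro h
  apply ha (-n)
  push_cast
  linear_combination h

theorem aux_mem {a : ℂ} (ha : ∀ z : ℤ, a ≠ (z : ℂ)) : a ∈ Complex.integerComplement := by
  rintro ⟨n, hn⟩
  exact ha n hn.symm

theorem aux_summ (a : ℂ) (k : ℕ) (hk : 2 ≤ k) :
    Summable fun n : ℤ => (1 : ℂ) / ((n : ℂ) + a) ^ k := by
  have h := EisensteinSeries.linear_right_summable a 1 (k := (k : ℤ)) (by exact_mod_cast hk)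
  refine h.congr fun n => ?_
  rw [zpow_natCast, one_div, Int.cast_one, one_mul, add_comm]

theorem aux_summ_mul (a b : ℂ) :
    Summable fun n : ℤ => (1 : ℂ) / (((n : ℂ) + a) * ((n : ℂ) + b)) := by
  refine Summable.of_norm_bounded ((aux_summ a 2 le_rfl).norm.add (aux_summ b 2 le_rfl).norm) ?_
  intro n
  rw [norm_div, norm_div, norm_div, norm_mul, norm_pow, norm_pow, norm_one, one_div, one_div,
    one_div, mul_inv, ← inv_pow, ← inv_pow]
  nlinarith [sq_nonneg (‖(n : ℂ) + a‖⁻¹ - ‖(n : ℂ) + b‖⁻¹), sq_nonneg (‖(n : ℂ) + a‖⁻¹),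
    sq_nonneg (‖(n : ℂ) + b‖⁻¹)]

theorem aux_sub {a b : ℂ} (ha : ∀ z : ℤ, a ≠ (z : ℂ)) (hb : ∀ z : ℤ, b ≠ (z : ℂ)) (n : ℤ) :
    1 / ((n : ℂ) + a) - 1 / ((n : ℂ) + b) = (b - a) * (1 / (((n : ℂ) + a) * ((n : ℂ) + b))) := by
  have h1 := aux_ne ha n
  have h2 := aux_ne hb n
  field_simp
  ring

theorem aux_cot {a b : ℂ} (ha : ∀ z : ℤ, a ≠ (z : ℂ)) (hb : ∀ z : ℤ, b ≠ (z : ℂ)) :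
    ∑' n : ℤ, (1 / ((n : ℂ) + a) - 1 / ((n : ℂ) + b))
      = Real.pi * Complex.cot (Real.pi * a) - Real.pi * Complex.cot (Real.pi * b) := by
  obtain ⟨f, hf⟩ : ∃ f : ℤ → ℂ, ∀ n : ℤ, f n = 1 / ((n : ℂ) + a) - 1 / ((n : ℂ) + b) :=
    ⟨_, fun _ => rfl⟩
  simp_rw [← hf]
  have hs : Summable f := by
    refine ((aux_summ_mul a b).mul_left (b - a)).congr fun n => ?_
    rw [hf, aux_sub ha hb]
  have s1 : Summable fun n : ℕ => f ((n : ℤ) + 1) := by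
    refine hs.comp_injective (i := fun n : ℕ => (n : ℤ) + 1) ?_
    intro m n h
    simpa using h
  have s2 : Summable fun n : ℕ => f (-((n : ℤ) + 1)) := by
    refine hs.comp_injective (i := fun n : ℕ => -((n : ℤ) + 1)) ?_
    intro m n h
    simpa using h
  have e : ∑' n : ℕ, (cotTerm a n - cotTerm b n)
     = (∑' n : ℕ, f ((n : ℤ) + 1)) + ∑' n : ℕ, f (-((n : ℤ) + 1)) := by
    rw [← s1.tsum_add s2]
    refine tsum_congr fun n => ?_
    rw [hf, hf]
    simp only [cotTerm]
    push_cast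
    ring
  rw [tsum_of_add_one_of_neg_add_one s1 s2]
  rw [(summable_cotTerm (aux_mem ha)).tsum_sub (summable_cotTerm (aux_mem hb))] at e
  have c1 := cot_series_rep' (aux_mem ha)
  have c2 := cot_series_rep' (aux_mem hb)
  simp only [cotTerm] at e
  rw [← c1, ← c2] at e
  rw [hf 0, Int.cast_zero, zero_add, zero_add]
  linear_combination (-1 : ℂ) * e

theorem aux_deriv {a : ℂ} (ha : ∀ z : ℤ, a ≠ (z : ℂ)) :
    HasDerivAt (fun z : ℂ => Real.pi * Complex.cot (Real.pi * z))
      (-((Real.pi : ℂ) ^ 2 * (Complex.sin (Real.pi * a))⁻¹ ^ 2)) a := by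
  have hs : Complex.sin (Real.pi * a) ≠ 0 := sin_pi_mul_ne_zero (aux_mem ha)
  have hl : HasDerivAt (fun z : ℂ => (Real.pi : ℂ) * z) Real.pi a := by
    simpa using (hasDerivAt_id a).const_mul (Real.pi : ℂ)
  have h := (((Complex.hasDerivAt_cos _).comp a hl).div ((Complex.hasDerivAt_sin _).comp a hl)
    hs).const_mul (Real.pi : ℂ)
  have h2 := Complex.sin_sq_add_cos_sq (Real.pi * a)
  convert! h using 1
  simp only [Function.comp]
  field_simp
  linear_combination h2

open Topology in
theorem aux_csc {a : ℂ} (ha : ∀ z : ℤ, a ≠ (z : ℂ)) :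
    ∑' n : ℤ, (1 : ℂ) / ((n : ℂ) + a) ^ 2
      = (Real.pi : ℂ) ^ 2 * (Complex.sin (Real.pi * a))⁻¹ ^ 2 := by
  have hopen : IsOpen (Complex.integerComplement) := Complex.isOpen_compl_range_intCast
  obtain ⟨r, hr, hball⟩ := Metric.isOpen_iff.1 hopen a (aux_mem ha)
  have hdist : ∀ n : ℤ, r ≤ ‖(n : ℂ) + a‖ := by
    intro n
    by_contra! hlt
    have : ((-n : ℤ) : ℂ) ∈ Metric.ball a r := by
      rw [Metric.mem_ball, dist_eq_norm, ← norm_neg]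
      have e : -(((-n : ℤ) : ℂ) - a) = (n : ℂ) + a := by
        push_cast
        ring
      rwa [e]
    exact hball this ⟨-n, rfl⟩
  have hmem : ∀ᶠ z in 𝓝[≠] a, z ∈ Metric.ball a (r / 2) ∧ z ≠ a :=
    (eventually_nhdsWithin_of_eventually_nhds (Metric.ball_mem_nhds a (by positivity))).and
      self_mem_nhdsWithin
  have hz : ∀ z ∈ Metric.ball a (r / 2), ∀ n : ℤ, z ≠ (n : ℂ) := by
    intro z hz n h
    exact hball (Metric.ball_subset_ball (by linarith) hz) ⟨n, h.symm⟩
  have t1 : Tendsto (fun z : ℂ => ∑' n : ℤ, (1 : ℂ) / (((n : ℂ) + a) * ((n : ℂ) + z))) (𝓝[≠] a)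
      (𝓝 (∑' n : ℤ, (1 : ℂ) / ((n : ℂ) + a) ^ 2)) := by
    refine tendsto_tsum_of_dominated_convergence
      (bound := fun n : ℤ => 2 * ‖(1 : ℂ) / ((n : ℂ) + a) ^ 2‖)
      ((aux_summ a 2 le_rfl).norm.mul_left 2) ?_ ?_
    · intro n
      have hn := aux_ne ha n
      have : ContinuousAt (fun z : ℂ => (1 : ℂ) / (((n : ℂ) + a) * ((n : ℂ) + z))) a := by
        refine ContinuousAt.div (by fun_prop) (by fun_prop) (mul_ne_zero hn hn)
      have h2 := this.tendsto.mono_left (nhdsWithin_le_nhds (s := {a}ᶜ))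
      rwa [← sq] at h2
    · filter_upwards [hmem] with z hz' n
      have h1 := hdist n
      have h3 : ‖z - a‖ < r / 2 := by simpa [dist_eq_norm] using hz'.1
      have h4 : ‖(n : ℂ) + a‖ ≤ ‖(n : ℂ) + z‖ + ‖z - a‖ := by
        have := norm_sub_le ((n : ℂ) + z) (z - a)
        have e : (n : ℂ) + z - (z - a) = (n : ℂ) + a := by ring
        rwa [e] at this
      have h5 : ‖(n : ℂ) + a‖ ≤ 2 * ‖(n : ℂ) + z‖ := by linarith
      have h6 : 0 < ‖(n : ℂ) + a‖ := by linarith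
      have h7 : 0 < ‖(n : ℂ) + z‖ := by linarith
      rw [norm_div, norm_div, norm_mul, norm_pow, norm_one, mul_one_div,
        div_le_div_iff₀ (by positivity) (by positivity)]
      nlinarith
  have t2 := (hasDerivAt_iff_tendsto_slope.1 (aux_deriv ha)).neg
  rw [neg_neg] at t2
  refine tendsto_nhds_unique t1 (t2.congr' ?_)
  filter_upwards [hmem] with z hz'
  have h1 := aux_cot ha (hz z hz'.1)
  simp_rw [aux_sub ha (hz z hz'.1)] at h1
  rw [tsum_mul_left] at h1
  have h2 : z - a ≠ 0 := sub_ne_zero.2 hz'.2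
  rw [slope_def_field, ← mul_right_inj' h2, h1]
  field_simp
  ring

/-- The inner sum over all integers. -/
theorem aux_inner {a b : ℂ} (ha : ∀ z : ℤ, a ≠ (z : ℂ)) (hb : ∀ z : ℤ, b ≠ (z : ℂ))
    (hc : b - a ≠ 0) :
    ∑' n : ℤ, (1 : ℂ) / (((n : ℂ) + a) ^ 2 * ((n : ℂ) + b) ^ 2)
      = ((Real.pi : ℂ) ^ 2 * ((Complex.sin (Real.pi * a))⁻¹ ^ 2
            + (Complex.sin (Real.pi * b))⁻¹ ^ 2)) / (b - a) ^ 2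
        + 2 * (Real.pi : ℂ) * (Complex.cot (Real.pi * b) - Complex.cot (Real.pi * a))
          / (b - a) ^ 3 := by
  have e : ∀ n : ℤ, (1 : ℂ) / (((n : ℂ) + a) ^ 2 * ((n : ℂ) + b) ^ 2)
      = (1 / (b - a) ^ 2) * (1 / ((n : ℂ) + a) ^ 2 + 1 / ((n : ℂ) + b) ^ 2)
        + (-2 / (b - a) ^ 3) * (1 / ((n : ℂ) + a) - 1 / ((n : ℂ) + b)) := by
    intro n
    rw [aux_sub ha hb]
    have h1 := aux_ne ha n
    have h2 := aux_ne hb n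
    field_simp
    ring
  have hs : Summable fun n : ℤ => (1 / ((n : ℂ) + a) - 1 / ((n : ℂ) + b)) := by
    simp_rw [aux_sub ha hb]
    exact (aux_summ_mul a b).mul_left _
  have sa := aux_summ a 2 le_rfl
  have sb := aux_summ b 2 le_rfl
  simp_rw [e]
  rw [((sa.add sb).mul_left _).tsum_add (hs.mul_left _), tsum_mul_left, tsum_mul_left,
    sa.tsum_add sb, aux_csc ha, aux_csc hb, aux_cot ha hb]
  ring

theorem aux_range_sq : Tendsto (fun N : ℕ => range N ×ˢ range N) atTop atTop := by
  refine tendsto_atTop_finset_of_monotone ?_ ?_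
  · intro m n h
    exact Finset.product_subset_product (Finset.range_mono h) (Finset.range_mono h)
  · rintro ⟨p, q⟩
    refine ⟨p + q + 1, ?_⟩
    simp only [mem_product, Finset.mem_range]
    omega

theorem aux_cmhz1 (k : ℕ) (x b : ℂ)
    (hs : Summable fun n : ℕ => x ^ (n + 1) / ((n : ℂ) + b) ^ k) :
    lih1 k x b = ∑' n : ℕ, x ^ (n + 1) / ((n : ℂ) + b) ^ k := by
  refine Tendsto.limUnder_eq ?_
  refine hs.hasSum.tendsto_sum_nat.congr fun N => ?_
  have h1 : Finset.univ.filter (fun n : Fin 1 → Fin N => StrictMono n) = Finset.univ := by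
    ext n
    simp [Subsingleton.strictMono]
  unfold cmhzP
  change _ = ∑ n ∈ Finset.univ.filter (fun n : Fin 1 → Fin N => StrictMono n),
    ∏ j : Fin 1, _
  rw [← Fin.sum_univ_eq_sum_range (fun n => x ^ (n + 1) / ((n : ℂ) + b) ^ k)]
  refine (Finset.sum_bij' (fun (n : Fin N) _ => (fun _ => n : Fin 1 → Fin N)) (fun n _ => n 0)
    ?_ ?_ ?_ ?_ ?_)
  · intro n _
    simp [Subsingleton.strictMono]
  · intro n _
    simp
  · intro n _
    rfl
  · intro n _
    ext i
    rw [Subsingleton.elim i 0]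
  · intro n _
    have e : (n : ℂ) + 1 + b - 1 = (n : ℂ) + b := by ring
    simp [e]

theorem aux_cmhz2 (k l : ℕ) (x y a b : ℂ)
    (hs : Summable fun p : ℕ × ℕ => if p.1 < p.2 then
      x ^ (p.1 + 1) / ((p.1 : ℂ) + a) ^ k * (y ^ (p.2 + 1) / ((p.2 : ℂ) + b) ^ l) else 0) :
    cmhz [(k, x, a), (l, y, b)] = ∑' p : ℕ × ℕ, if p.1 < p.2 then
      x ^ (p.1 + 1) / ((p.1 : ℂ) + a) ^ k * (y ^ (p.2 + 1) / ((p.2 : ℂ) + b) ^ l) else 0 := by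
  refine Tendsto.limUnder_eq ?_
  have h := hs.hasSum.comp aux_range_sq
  refine h.congr fun N => ?_
  unfold cmhzP
  change _ = ∑ n ∈ Finset.univ.filter (fun n : Fin 2 → Fin N => StrictMono n),
    ∏ j : Fin 2, _
  simp only [Function.comp]
  rw [← Finset.sum_filter]
  symm
  refine Finset.sum_bij (fun (n : Fin 2 → Fin N) _ => ((n 0 : ℕ), (n 1 : ℕ))) ?_ ?_ ?_ ?_
  · intro n hn
    simp only [mem_filter, Finset.mem_univ, true_and] at hn
    have := hn (show (0 : Fin 2) < 1 by decide)
    simp only [mem_filter, mem_product, Finset.mem_range, Fin.is_lt, true_and]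
    exact this
  · intro n _ m _ h
    simp only [Prod.mk.injEq] at h
    ext i
    fin_cases i
    · exact h.1
    · exact h.2
  · rintro ⟨p, q⟩ hp
    simp only [mem_filter, mem_product, Finset.mem_range] at hp
    refine ⟨![⟨p, hp.1.1⟩, ⟨q, hp.1.2⟩], ?_, rfl⟩
    simp only [mem_filter, Finset.mem_univ, true_and]
    intro i j hij
    fin_cases i <;> fin_cases j <;> simp_all
  · intro n _
    rw [Fin.prod_univ_two]
    have e1 : ((n 0 : ℕ) : ℂ) + 1 + a - 1 = (n 0 : ℕ) + a := by ring
    have e2 : ((n 1 : ℕ) : ℂ) + 1 + b - 1 = (n 1 : ℕ) + b := by ring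
    simp [e1, e2]

/-- The full two-sided summand. -/
noncomputable def auxG (x a b : ℂ) (p : ℤ × ℤ) : ℂ :=
  x ^ (p.2 - p.1) * (1 / ((p.1 : ℂ) + a) ^ 2 * (1 / ((p.2 : ℂ) + b) ^ 2))

open scoped Classical in
/-- The summand restricted to a set. -/
noncomputable def auxH (x a b : ℂ) (s : ℤ × ℤ → Prop) (p : ℤ × ℤ) : ℂ :=
  if s p then auxG x a b p else 0

theorem auxH_summable {x : ℂ} (hx : ‖x‖ = 1) (a b : ℂ) (s : ℤ × ℤ → Prop) :
    Summable (auxH x a b s) := by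
  have h := summable_mul_of_summable_norm (aux_summ a 2 le_rfl).norm (aux_summ b 2 le_rfl).norm
  refine Summable.of_norm_bounded h.norm fun p => ?_
  unfold auxH auxG
  split_ifs
  · rw [norm_mul, norm_zpow, hx, one_zpow, one_mul]
  · rw [norm_zero]
    exact norm_nonneg _

theorem auxH_tsum (x a b : ℂ) (s : ℤ × ℤ → Prop) {γ : Type} (e : γ → ℤ × ℤ)
    (he : Function.Injective e) (hs : ∀ p, s p → p ∈ Set.range e) :
    ∑' p, auxH x a b s p = ∑' g, auxH x a b s (e g) := by
  refine (he.tsum_eq ?_).symm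
  intro p hp
  by_contra hn
  apply hp
  unfold auxH
  rw [if_neg fun h => hn (hs p h)]

theorem auxH_split {x : ℂ} (hx : ‖x‖ = 1) (a b : ℂ) :
    ∑' p, auxH x a b (fun p => p.1 < p.2) p
      = ∑' p, auxH x a b (fun p => 0 ≤ p.1 ∧ p.1 < p.2) p
        + ∑' p, auxH x a b (fun p => p.1 < p.2 ∧ p.2 < 0) p
        + ∑' p, auxH x a b (fun p => p.1 < 0 ∧ 0 ≤ p.2) p := by
  rw [← (auxH_summable hx a b _).tsum_add (auxH_summable hx a b _),
    ← ((auxH_summable hx a b _).add (auxH_summable hx a b _)).tsum_add (auxH_summable hx a b _)]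
  refine tsum_congr fun p => ?_
  obtain ⟨i, j⟩ := p
  unfold auxH
  simp only
  split_ifs <;> first | (exfalso; omega) | simp

theorem aux_S1 {x : ℂ} (hx : ‖x‖ = 1) (a b : ℂ) :
    cmhz [(2, x⁻¹, a), (2, x, b)] = ∑' p, auxH x a b (fun p => 0 ≤ p.1 ∧ p.1 < p.2) p := by
  have hx0 : x ≠ 0 := by
    rintro rfl
    simp at hx
  have hinj : Function.Injective (fun p : ℕ × ℕ => ((p.1 : ℤ), (p.2 : ℤ))) := by
    rintro ⟨p, q⟩ ⟨r, s⟩ h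
    simpa using h
  have key : ∀ p : ℕ × ℕ, auxH x a b (fun p => 0 ≤ p.1 ∧ p.1 < p.2) ((p.1 : ℤ), (p.2 : ℤ))
      = if p.1 < p.2 then
        x⁻¹ ^ (p.1 + 1) / ((p.1 : ℂ) + a) ^ 2 * (x ^ (p.2 + 1) / ((p.2 : ℂ) + b) ^ 2) else 0 := by
    rintro ⟨p, q⟩
    unfold auxH auxG
    by_cases h : p < q
    · have e : x ^ ((q : ℤ) - (p : ℤ)) = x⁻¹ ^ (p + 1) * x ^ (q + 1) := by
        rw [inv_pow, zpow_sub₀ hx0, zpow_natCast, zpow_natCast]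
        field_simp
        ring
      simp only [Int.natCast_nonneg, Nat.cast_lt, h, true_and, if_true, e, Int.cast_natCast]
      ring
    · simp [h]
  rw [aux_cmhz2, auxH_tsum x a b _ _ hinj]
  · exact tsum_congr fun p => (key p).symm
  · rintro ⟨i, j⟩ ⟨h1, h2⟩
    simp only at h1 h2
    refine ⟨(i.toNat, j.toNat), ?_⟩
    simp only [Prod.mk.injEq]
    omega
  · exact ((auxH_summable hx a b _).comp_injective hinj).congr fun p => key p

theorem aux_S2 {x : ℂ} (hx : ‖x‖ = 1) (a b : ℂ) :
    cmhz [(2, x⁻¹, 1 - b), (2, x, 1 - a)]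
      = ∑' p, auxH x a b (fun p => p.1 < p.2 ∧ p.2 < 0) p := by
  have hx0 : x ≠ 0 := by
    rintro rfl
    simp at hx
  have hinj : Function.Injective (fun p : ℕ × ℕ => (-((p.2 : ℤ) + 1), -((p.1 : ℤ) + 1))) := by
    rintro ⟨p, q⟩ ⟨r, s⟩ h
    simp only [Prod.mk.injEq] at h ⊢
    omega
  have key : ∀ p : ℕ × ℕ, auxH x a b (fun p => p.1 < p.2 ∧ p.2 < 0)
        (-((p.2 : ℤ) + 1), -((p.1 : ℤ) + 1))
      = if p.1 < p.2 then
        x⁻¹ ^ (p.1 + 1) / ((p.1 : ℂ) + (1 - b)) ^ 2 * (x ^ (p.2 + 1) / ((p.2 : ℂ) + (1 - a)) ^ 2)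
        else 0 := by
    rintro ⟨p, q⟩
    unfold auxH auxG
    by_cases h : p < q
    · have e : x ^ (-((p : ℤ) + 1) - -((q : ℤ) + 1)) = x⁻¹ ^ (p + 1) * x ^ (q + 1) := by
        rw [show -((p : ℤ) + 1) - -((q : ℤ) + 1) = (q : ℤ) - p by ring,
          inv_pow, zpow_sub₀ hx0, zpow_natCast, zpow_natCast]
        field_simp
        ring
      have e1 : (((-((p : ℤ) + 1) : ℤ) : ℂ) + b) ^ 2 = ((p : ℂ) + (1 - b)) ^ 2 := by
        push_cast
        ring
      have e2 : (((-((q : ℤ) + 1) : ℤ) : ℂ) + a) ^ 2 = ((q : ℂ) + (1 - a)) ^ 2 := by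
        push_cast
        ring
      have h' : -((q : ℤ) + 1) < -((p : ℤ) + 1) ∧ -((p : ℤ) + 1) < 0 := by omega
      simp only [h, if_true, e, e1, e2]
      rw [if_pos h']
      ring
    · have h' : ¬ (-((q : ℤ) + 1) < -((p : ℤ) + 1) ∧ -((p : ℤ) + 1) < 0) := by omega
      simp only [h, if_false]
      rw [if_neg h']
  rw [aux_cmhz2, auxH_tsum x a b _ _ hinj]
  · exact tsum_congr fun p => (key p).symm
  · rintro ⟨i, j⟩ ⟨h1, h2⟩
    simp only at h1 h2
    refine ⟨((-j - 1).toNat, (-i - 1).toNat), ?_⟩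
    simp only [Prod.mk.injEq]
    omega
  · exact ((auxH_summable hx a b _).comp_injective hinj).congr fun p => key p

theorem aux_summ1 {x : ℂ} (hx : ‖x‖ = 1) (a : ℂ) (k : ℕ) (hk : 2 ≤ k) :
    Summable fun n : ℕ => x ^ (n + 1) / ((n : ℂ) + a) ^ k := by
  refine Summable.of_norm_bounded
    (((aux_summ a k hk).comp_injective (i := fun n : ℕ => (n : ℤ)) Nat.cast_injective).norm)
    fun n => ?_
  simp [hx]

theorem aux_S3 {x : ℂ} (hx : ‖x‖ = 1) (a b : ℂ) :
    x⁻¹ * lih1 2 x b * lih1 2 x (1 - a)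
      = ∑' p, auxH x a b (fun p => p.1 < 0 ∧ 0 ≤ p.2) p := by
  have hx0 : x ≠ 0 := by
    rintro rfl
    simp at hx
  have hinj : Function.Injective (fun p : ℕ × ℕ => (-((p.2 : ℤ) + 1), (p.1 : ℤ))) := by
    rintro ⟨p, q⟩ ⟨r, s⟩ h
    simp only [Prod.mk.injEq] at h ⊢
    omega
  have s1 := aux_summ1 hx b 2 le_rfl
  have s2 := aux_summ1 hx (1 - a) 2 le_rfl
  rw [aux_cmhz1 2 x b s1, aux_cmhz1 2 x (1 - a) s2, mul_assoc,
    tsum_mul_tsum_of_summable_norm s1.norm s2.norm, ← tsum_mul_left,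
    auxH_tsum x a b _ _ hinj]
  · refine tsum_congr ?_
    rintro ⟨p, q⟩
    unfold auxH auxG
    have e : x ^ ((p : ℤ) - -((q : ℤ) + 1)) = x⁻¹ * (x ^ (p + 1) * x ^ (q + 1)) := by
      rw [show (p : ℤ) - -((q : ℤ) + 1) = ((p + q + 1 : ℕ) : ℤ) by push_cast; ring, zpow_natCast]
      field_simp
      ring
    have e2 : (((-((q : ℤ) + 1) : ℤ) : ℂ) + a) ^ 2 = ((q : ℂ) + (1 - a)) ^ 2 := by
      push_cast
      ring
    have h' : -((q : ℤ) + 1) < 0 ∧ (0 : ℤ) ≤ (p : ℤ) := by omega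
    simp only [e, e2, Int.cast_natCast]
    rw [if_pos h']
    ring
  · rintro ⟨i, j⟩ ⟨h1, h2⟩
    simp only at h1 h2
    refine ⟨(j.toNat, (-i - 1).toNat), ?_⟩
    simp only [Prod.mk.injEq]
    omega

theorem aux_total {x : ℂ} (hx : ‖x‖ = 1) {a b : ℂ} (ha : ∀ z : ℤ, a ≠ (z : ℂ))
    (hb : ∀ z : ℤ, b ≠ (z : ℂ)) (hba : ∀ t : ℕ, b - a ≠ -((t : ℂ) + 1)) :
    ∑' p, auxH x a b (fun p => p.1 < p.2) p
      = (Real.pi : ℂ) ^ 2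
          * ((Complex.sin ((Real.pi : ℂ) * a))⁻¹ ^ 2 + (Complex.sin ((Real.pi : ℂ) * b))⁻¹ ^ 2)
          * lih1 2 x (1 + b - a)
        + 2 * (Real.pi : ℂ) * (Complex.cot (Real.pi * b) - Complex.cot (Real.pi * a))
          * lih1 3 x (1 + b - a) := by
  have hinj : Function.Injective (fun p : ℕ × ℤ => (p.2, p.2 + (p.1 : ℤ) + 1)) := by
    rintro ⟨p, q⟩ ⟨r, s⟩ h
    simp only [Prod.mk.injEq] at h ⊢
    omega
  have s2 := aux_summ1 hx (1 + b - a) 2 le_rfl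
  have s3 := aux_summ1 hx (1 + b - a) 3 (by norm_num)
  rw [auxH_tsum x a b _ _ hinj]
  · have hsum := (auxH_summable hx a b (fun p => p.1 < p.2)).comp_injective hinj
    refine (hsum.tsum_prod).trans ?_
    rw [aux_cmhz1 2 _ _ s2, aux_cmhz1 3 _ _ s3, ← tsum_mul_left, ← tsum_mul_left,
      ← (s2.mul_left _).tsum_add (s3.mul_left _)]
    refine tsum_congr fun t => ?_
    have hb' : ∀ z : ℤ, b + ((t : ℂ) + 1) ≠ (z : ℂ) := by
      intro z h
      apply hb (z - ((t : ℤ) + 1))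
      push_cast
      linear_combination h
    have hc : b + ((t : ℂ) + 1) - a ≠ 0 := by
      intro h
      apply hba t
      linear_combination h
    have hin := aux_inner ha hb' hc
    have hang : (Real.pi : ℂ) * (b + ((t : ℂ) + 1)) = Real.pi * b + ((t + 1 : ℕ) : ℂ) * Real.pi := by
      push_cast
      ring
    have hsin : (Complex.sin ((Real.pi : ℂ) * (b + ((t : ℂ) + 1))))⁻¹ ^ 2
        = (Complex.sin ((Real.pi : ℂ) * b))⁻¹ ^ 2 := by
      rw [hang, Complex.sin_antiperiodic.add_nat_mul_eq, inv_pow, inv_pow, mul_pow, ← pow_mul, mul_comm (t + 1) 2,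
        pow_mul, neg_one_sq, one_pow, one_mul]
    have hcot : Complex.cot ((Real.pi : ℂ) * (b + ((t : ℂ) + 1)))
        = Complex.cot ((Real.pi : ℂ) * b) := by
      rw [hang, Complex.cot, Complex.cot, Complex.sin_antiperiodic.add_nat_mul_eq, Complex.cos_antiperiodic.add_nat_mul_eq]
      exact mul_div_mul_left _ _ (pow_ne_zero _ (by norm_num))
    rw [hsin, hcot] at hin
    have hterm : ∀ i : ℤ, (auxH x a b (fun p => p.1 < p.2) ∘
        fun p : ℕ × ℤ => (p.2, p.2 + (p.1 : ℤ) + 1)) (t, i)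
        = x ^ (t + 1) * (1 / (((i : ℂ) + a) ^ 2 * ((i : ℂ) + (b + ((t : ℂ) + 1))) ^ 2)) := by
      intro i
      have h' : i < i + (t : ℤ) + 1 := by omega
      simp only [Function.comp, auxH, auxG]
      rw [if_pos h', show i + (t : ℤ) + 1 - i = ((t + 1 : ℕ) : ℤ) by push_cast; ring, zpow_natCast,
        one_div_mul_one_div]
      push_cast
      ring
    rw [tsum_congr hterm, tsum_mul_left, hin,
      show b + ((t : ℂ) + 1) - a = (t : ℂ) + (1 + b - a) by ring]
    ring
  · rintro ⟨i, j⟩ h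
    simp only at h
    refine ⟨((j - i - 1).toNat, i), ?_⟩
    refine Prod.ext rfl ?_
    change i + ((j - i - 1).toNat : ℤ) + 1 = j
    omega

/-- First example after Corollary `corone-sect-4`. -/
theorem example_Li22_symmetric (x : ℂ) (hx : IsRootOfUnity x)
    (a b : ℂ) (ha : ∀ z : ℤ, a ≠ (z : ℂ)) (hb : ∀ z : ℤ, b ≠ (z : ℂ))
    (hba : ∀ t : ℕ, b - a ≠ -((t : ℂ) + 1)) :
    cmhz [(2, x⁻¹, a), (2, x, b)] + cmhz [(2, x⁻¹, 1 - b), (2, x, 1 - a)]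
      + x⁻¹ * lih1 2 x b * lih1 2 x (1 - a)
      = (Real.pi : ℂ) ^ 2
          * ((Complex.sin ((Real.pi : ℂ) * a))⁻¹ ^ 2 + (Complex.sin ((Real.pi : ℂ) * b))⁻¹ ^ 2)
          * lih1 2 x (1 + b - a)
        + 2 * (Real.pi : ℂ)
          * (Complex.cos ((Real.pi : ℂ) * b) / Complex.sin ((Real.pi : ℂ) * b)
              - Complex.cos ((Real.pi : ℂ) * a) / Complex.sin ((Real.pi : ℂ) * a))
          * lih1 3 x (1 + b - a) := by
  obtain ⟨N, hN, hxN⟩ := hx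
  have hx1 : ‖x‖ = 1 := Complex.norm_eq_one_of_pow_eq_one hxN hN.ne'
  rw [aux_S1 hx1 a b, aux_S2 hx1 a b, aux_S3 hx1 a b, ← auxH_split hx1 a b,
    aux_total hx1 ha hb hba]
  rfl
end
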